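/- arXiv:math/0608367 — 6 statements merged into one kernel-verified Lean document; each statement's English description precedes it below -/
import Mathlib

section
/- The rank of a matrix is a mutation invariant: if B is a skew-symmetric n×n integer matrix and k ∈ {1,…,n}, then the rank of μ_k(B) equals the rank of B, where the rank of an integer matrix is computed over the rationals. -/
open Matrix

/-- Mutation of a square integer matrix `B` in direction `k`:
`(μ_k B) i j = -B i j` if `i = k` or `j = k`, and otherwise
`B i j + [B i k]₊ [B k j]₊ - [-B i k]₊ [-B k j]₊`. -/
def mutate {m : Type*} [DecidableEq m] (B : Matrix m m ℤ) (k : m) : Matrix m m ℤ :=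
  Matrix.of fun i j =>
    if i = k ∨ j = k then -(B i j)
    else B i j + max (B i k) 0 * max (B k j) 0 - max (-(B i k)) 0 * max (-(B k j)) 0

/-- Two square integer matrices are mutation equivalent if one is obtained from the
other by a finite sequence of mutations. -/
def MutEquiv {m : Type*} [DecidableEq m] (B C : Matrix m m ℤ) : Prop :=
  Relation.ReflTransGen (fun X Y => ∃ k, Y = mutate X k) B C

theorem mutate_rank_le {n : ℕ} (B : Matrix (Fin n) (Fin n) ℤ) (k : Fin n) (hk : B k k = 0) :
    ((mutate B k).map (Int.cast : ℤ → ℚ)).rank ≤ (B.map (Int.cast : ℤ → ℚ)).rank := by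
  let u : Fin n → ℤ := fun i => if i = k then -2 else max (-(B i k)) 0
  let v : Fin n → ℤ := fun j => if j = k then -2 else max (B k j) 0
  have h : mutate B k = (1 + Matrix.vecMulVec u (Pi.single k 1)) * B *
      (1 + Matrix.vecMulVec (Pi.single k 1) v) := by
    have h1 : (1 + Matrix.vecMulVec u (Pi.single k 1)) * B =
        Matrix.of fun i j => B i j + u i * B k j := by
      ext i j
      simp [add_mul, Matrix.vecMulVec_mul, Matrix.vecMulVec_apply]
    rw [h1]
    ext i j
    simp only [mul_add, mul_one, Matrix.mul_vecMulVec, Matrix.add_apply, Matrix.vecMulVec_apply,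
      Matrix.mulVec_single_one, Matrix.col_apply, Matrix.of_apply, mutate, u, v, hk]
    by_cases hi : i = k <;> by_cases hj : j = k
    · subst hi; subst hj; simp [hk]
    · subst hi; simp [hk, hj]; ring
    · subst hj; simp [hk, hi]; ring
    · simp only [hi, hj, if_false, or_self]
      have e1 : B i k = max (B i k) 0 - max (-(B i k)) 0 := by omega
      have e2 : B k j = max (B k j) 0 - max (-(B k j)) 0 := by omega
      generalize max (B i k) 0 = a at *
      generalize max (-(B i k)) 0 = b at *
      generalize max (B k j) 0 = c at *
      generalize max (-(B k j)) 0 = d at *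
      rw [e1, e2]; ring
  have hm : ∀ M : Matrix (Fin n) (Fin n) ℤ,
      M.map (Int.cast : ℤ → ℚ) = (Int.castRingHom ℚ).mapMatrix M := fun M => rfl
  rw [h, hm, map_mul, map_mul]
  exact (Matrix.rank_mul_le_left _ _).trans (Matrix.rank_mul_le_right _ _)

theorem mutate_mutate {n : ℕ} (B : Matrix (Fin n) (Fin n) ℤ) (k : Fin n) :
    mutate (mutate B k) k = B := by
  ext i j
  by_cases hi : i = k <;> by_cases hj : j = k <;> simp [mutate, hi, hj]

/-- The rank (computed over ℚ) of a skew-symmetric integer matrix is invariant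
under matrix mutation. -/
theorem rank_mutate {n : ℕ} (B : Matrix (Fin n) (Fin n) ℤ) (hB : Bᵀ = -B) (k : Fin n) :
    ((mutate B k).map (Int.cast : ℤ → ℚ)).rank = (B.map (Int.cast : ℤ → ℚ)).rank := by
  have hk : B k k = 0 := by
    have := congrFun (congrFun hB k) k
    simp only [Matrix.transpose_apply, Matrix.neg_apply] at this
    omega
  refine le_antisymm (mutate_rank_le B k hk) ?_
  have := mutate_rank_le (mutate B k) k (by simp [mutate, hk])
  rwa [mutate_mutate] at this
end

section
/- Let n ≥ 3 and let ε, ε' : ℤ/nℤ → {+1,−1} be two orientations of the n-cycle. Then there exists a permutation σ of ℤ/nℤ such that B_ε is mutation equivalent to the matrix ((B_{ε'})_{σ(i),σ(j)})_{i,j} (the simultaneous relabeling of rows and columns of B_{ε'} by σ) if and only if the unordered pairs {n₁(ε), n₂(ε)} and {n₁(ε'), n₂(ε')} coincide. -/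
open Matrix

/-- For `ε : ZMod n → ℤ` (with values ±1), the skew-symmetric matrix of the
orientation of the `n`-cycle in which the edge between `i` and `i+1` is directed
`i → i+1` exactly when `ε i = 1`. -/
def cycleMatrix (n : ℕ) [NeZero n] (ε : ZMod n → ℤ) : Matrix (ZMod n) (ZMod n) ℤ :=
  Matrix.of fun i j => if j = i + 1 then ε i else if i = j + 1 then -(ε j) else 0


namespace CycleMut

/-! ### Sinks and sources -/

lemma mutate_mutate {m : Type*} [DecidableEq m] (B : Matrix m m ℤ) (k : m) :
    mutate (mutate B k) k = B := by
  ext i j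
  simp only [mutate, Matrix.of_apply]
  by_cases hi : i = k
  · simp [hi]
  · by_cases hj : j = k
    · simp [hj]
    · simp [hi, hj]

lemma MutEquiv.symm' {m : Type*} [DecidableEq m] {B C : Matrix m m ℤ} (h : MutEquiv B C) :
    MutEquiv C B := by
  unfold MutEquiv at *
  induction h with
  | refl => exact Relation.ReflTransGen.refl
  | tail _ hk ih =>
    obtain ⟨k, rfl⟩ := hk
    exact Relation.ReflTransGen.head ⟨k, (mutate_mutate _ k).symm⟩ ih

lemma mutate_submatrix {m : Type*} [DecidableEq m] (B : Matrix m m ℤ) (k : m)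
    (σ : Equiv.Perm m) :
    (mutate B k).submatrix σ σ = mutate (B.submatrix σ σ) (σ.symm k) := by
  ext i j
  simp [mutate, Equiv.eq_symm_apply]

lemma MutEquiv.submatrix' {m : Type*} [DecidableEq m] {B C : Matrix m m ℤ} (h : MutEquiv B C)
    (σ : Equiv.Perm m) : MutEquiv (B.submatrix σ σ) (C.submatrix σ σ) := by
  unfold MutEquiv at *
  induction h with
  | refl => exact Relation.ReflTransGen.refl
  | tail _ hk ih =>
    obtain ⟨k, rfl⟩ := hk
    exact Relation.ReflTransGen.tail ih ⟨_, mutate_submatrix _ k σ⟩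

lemma two_ne (n : ℕ) (hn : 3 ≤ n) : (2 : ZMod n) ≠ 0 := by
  intro h
  have : ((2 : ℕ) : ZMod n) = 0 := by exact_mod_cast h
  rw [ZMod.natCast_eq_zero_iff] at this
  have := Nat.le_of_dvd (by norm_num) this
  omega

lemma one_ne (n : ℕ) (hn : 3 ≤ n) : (1 : ZMod n) ≠ 0 := by
  intro h
  have : ((1 : ℕ) : ZMod n) = 0 := by exact_mod_cast h
  rw [ZMod.natCast_eq_zero_iff] at this
  have := Nat.le_of_dvd (by norm_num) this
  omega

lemma max_aux (u v e : ℤ) (hu : u = 0 ∨ u = e) (hv : v = 0 ∨ v = -e) :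
    max u 0 * max v 0 - max (-u) 0 * max (-v) 0 = 0 := by
  rcases hu with rfl | rfl <;> rcases hv with rfl | rfl <;> simp
  ring

lemma mutate_cycle (n : ℕ) [NeZero n] (hn : 3 ≤ n) (ε : ZMod n → ℤ) (k : ZMod n)
    (h : ε (k + 1) = - ε k) :
    mutate (cycleMatrix n ε) (k + 1) = cycleMatrix n (ε ∘ Equiv.swap k (k + 1)) := by
  have h1 := one_ne n hn
  have h2 := two_ne n hn
  have a1 : ∀ x : ZMod n, x ≠ x + 1 := fun x hx => h1 (by linear_combination -hx)
  have a2 : ∀ x : ZMod n, x ≠ x + 1 + 1 := fun x hx => h2 (by linear_combination -hx)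
  have i1 : ∀ x y : ZMod n, x + 1 = y + 1 → x = y := fun x y => (add_left_inj 1).1
  have key : ∀ x, (ε ∘ Equiv.swap k (k+1)) x = if x = k then - ε k else if x = k + 1 then ε k
      else ε x := by
    intro x
    simp only [Function.comp, Equiv.swap_apply_def]
    split_ifs <;> simp [h]
  ext i j
  simp only [mutate, Matrix.of_apply]
  by_cases hij : i = k + 1 ∨ j = k + 1
  · rw [if_pos hij]
    simp only [cycleMatrix, Matrix.of_apply, key]
    clear key
    generalize hk2 : k + 1 + 1 = k2
    have := a1 k; have := a2 k; have := a1 (k+1); have := a2 (k+1)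
    have := i1 i k; have := i1 j k; have := i1 i (k+1); have := i1 j (k+1)
    rcases hij with rfl | rfl
    · grind
    · grind
  · rw [if_neg hij, add_sub_assoc, max_aux _ _ (ε k), add_zero]
    · push Not at hij
      obtain ⟨hi, hj⟩ := hij
      simp only [cycleMatrix, Matrix.of_apply, key]
      have := i1 i k; have := i1 j k
      clear key
      grind
    · simp only [cycleMatrix, Matrix.of_apply]
      have := i1 i k
      grind
    · simp only [cycleMatrix, Matrix.of_apply]
      have := i1 j k
      grind

def Good (n : ℕ) [NeZero n] (σ : Equiv.Perm (ZMod n)) : Prop :=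
  ∀ ε : ZMod n → ℤ, (∀ i, ε i = 1 ∨ ε i = -1) →
    MutEquiv (cycleMatrix n ε) (cycleMatrix n (ε ∘ σ))

lemma Good.mul {n : ℕ} [NeZero n] {σ τ : Equiv.Perm (ZMod n)} (h1 : Good n σ) (h2 : Good n τ) :
    Good n (σ * τ) := by
  intro ε hε
  have := h2 (ε ∘ σ) (fun i => hε _)
  exact Relation.ReflTransGen.trans (h1 ε hε) this

lemma good_adj {n : ℕ} [NeZero n] (hn : 3 ≤ n) (k : ZMod n) : Good n (Equiv.swap k (k + 1)) := by
  intro ε hε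
  by_cases h : ε (k + 1) = - ε k
  · exact Relation.ReflTransGen.single ⟨k + 1, (mutate_cycle n hn ε k h).symm⟩
  · have : ε (k + 1) = ε k := by
      rcases hε k with h' | h' <;> rcases hε (k+1) with h'' | h'' <;> simp_all
    have : ε ∘ Equiv.swap k (k + 1) = ε := by
      ext x
      simp only [Function.comp, Equiv.swap_apply_def]
      split_ifs <;> simp_all
    rw [this]
    exact Relation.ReflTransGen.refl

lemma good_one (n : ℕ) [NeZero n] : Good n 1 := fun _ _ => Relation.ReflTransGen.refl

lemma good_swap_nat {n : ℕ} [NeZero n] (hn : 3 ≤ n) (k : ZMod n) (m : ℕ) :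
    Good n (Equiv.swap k (k + m)) := by
  induction m with
  | zero => simp only [Nat.cast_zero, add_zero, Equiv.swap_self]; exact good_one n
  | succ m ih =>
    have h1 := one_ne n hn
    have e : (k + ((m + 1 : ℕ) : ZMod n)) = k + m + 1 := by push_cast; ring
    rw [e]
    by_cases h : k = k + m
    · rw [← h]; exact good_adj hn k
    by_cases h' : k = k + m + 1
    · rw [← h', Equiv.swap_self]; exact good_one n
    rw [Equiv.swap_comm, ← Equiv.swap_mul_swap_mul_swap (x := k) (y := k + m) (z := k + m + 1) h h',]
    exact ((good_adj hn _).mul ih).mul (good_adj hn _)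

lemma good_all {n : ℕ} [NeZero n] (hn : 3 ≤ n) (σ : Equiv.Perm (ZMod n)) : Good n σ := by
  induction σ using Equiv.Perm.swap_induction_on with
  | one => exact good_one n
  | swap_mul f x y _ ih =>
    have := good_swap_nat hn x (y - x).val
    rw [ZMod.natCast_zmod_val, add_sub_cancel] at this
    exact this.mul ih

lemma mutEquiv_of_card {n : ℕ} [NeZero n] (hn : 3 ≤ n) (ε ε' : ZMod n → ℤ)
    (hε : ∀ i, ε i = 1 ∨ ε i = -1) (hε' : ∀ i, ε' i = 1 ∨ ε' i = -1)
    (h : (Finset.univ.filter fun i => ε i = 1).card = (Finset.univ.filter fun i => ε' i = 1).card) :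
    MutEquiv (cycleMatrix n ε) (cycleMatrix n ε') := by
  have e : {i // ε' i = 1} ≃ {i // ε i = 1} := Fintype.equivOfCardEq (by
    rw [Fintype.card_subtype, Fintype.card_subtype, h])
  have : ε' = ε ∘ e.extendSubtype := by
    ext i
    by_cases hi : ε' i = 1
    · rw [hi]; exact (e.extendSubtype_mem i hi).symm
    · have := e.extendSubtype_not_mem i hi
      have h1 := hε' i
      have h2 := hε (e.extendSubtype i)
      simp only [Function.comp]
      grind
  rw [this]
  exact good_all hn _ ε hε

lemma card_neg {n : ℕ} [NeZero n] (ε : ZMod n → ℤ)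
    (hε : ∀ i, ε i = 1 ∨ ε i = -1) :
    (Finset.univ.filter fun i => ε i = -1).card = n - (Finset.univ.filter fun i => ε i = 1).card := by
  have h := Finset.card_filter_add_card_filter_not (s := (Finset.univ : Finset (ZMod n)))
    (fun i => ε i = 1)
  have : (Finset.univ.filter fun i => ¬ ε i = 1) = (Finset.univ.filter fun i => ε i = -1) := by
    ext i; have := hε i; simp; grind
  rw [this, Finset.card_univ, ZMod.card] at h
  omega

lemma exists_of_card' {n : ℕ} [NeZero n] (hn : 3 ≤ n) (ε ε' : ZMod n → ℤ)
    (hε : ∀ i, ε i = 1 ∨ ε i = -1) (hε' : ∀ i, ε' i = 1 ∨ ε' i = -1)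
    (h : (Finset.univ.filter fun i => ε i = 1).card =
      n - (Finset.univ.filter fun i => ε' i = 1).card) :
    ∃ σ : Equiv.Perm (ZMod n),
        MutEquiv (cycleMatrix n ε) ((cycleMatrix n ε').submatrix σ σ) := by
  refine ⟨Equiv.neg _, ?_⟩
  have h2 := two_ne n hn
  have e : (cycleMatrix n ε').submatrix (Equiv.neg (ZMod n)) (Equiv.neg (ZMod n)) =
      cycleMatrix n (fun i => - ε' (-i - 1)) := by
    ext i j
    simp only [cycleMatrix, Matrix.submatrix_apply, Matrix.of_apply, Equiv.neg_apply]
    by_cases h1 : j = i + 1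
    · subst h1
      have : ¬ (-(i + 1) = -i + 1) := fun h => h2 (by linear_combination -h)
      have e1 : -i = -(i + 1) + 1 := by ring
      rw [if_neg this, if_pos e1, if_pos rfl]
      congr 2
      ring
    · by_cases h3 : i = j + 1
      · subst h3
        have : ¬ (j = j + 1 + 1) := fun h => h2 (by linear_combination -h)
        simp [this]
        congr 1
        ring
      · have a : ¬ (-j = -i + 1) := fun h => h3 (by linear_combination h)
        have b : ¬ (-i = -j + 1) := fun h => h1 (by linear_combination h)
        simp [h1, h3, a, b]
  rw [e]
  apply mutEquiv_of_card hn _ _ hε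
  · intro i; have := hε' (-i - 1); grind
  · rw [h, ← card_neg ε' hε']
    let f : ZMod n ≃ ZMod n := (Equiv.neg _).trans (Equiv.subRight 1)
    apply Finset.card_bij' (fun i _ => f.symm i) (fun i _ => f i)
    · intro i hi; simp [f] at hi ⊢; simp [hi]
    · intro i hi; simp [f] at hi ⊢; omega
    · simp
    · simp

end CycleMut

namespace CycleMut

/-! ### Combinatorial triangulations -/

abbrev H (D : Type) := (D × Bool) ⊕ D

/-- opposite half-edge (boundary half-edges are fixed) -/
def op {D : Type} : H D → H D
  | Sum.inl (i, s) => Sum.inl (i, !s)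
  | Sum.inr b => Sum.inr b

/-- indicator that the half-edge belongs to the diagonal `i` -/
def ph {D : Type} [DecidableEq D] (i : D) : H D → ℤ
  | Sum.inl (j, _) => if j = i then 1 else 0
  | Sum.inr _ => 0

set_option linter.unusedSectionVars false

variable {D : Type}

@[simp] lemma op_op (x : H D) : op (op x) = x := by
  rcases x with ⟨i, s⟩ | b <;> simp [op]

lemma ph_op [DecidableEq D] (i : D) (x : H D) : ph i (op x) = ph i x := by
  rcases x with ⟨i, s⟩ | b <;> simp [op, ph]

lemma ph_nonneg [DecidableEq D] (i : D) (x : H D) : 0 ≤ ph i x := by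
  rcases x with ⟨j, s⟩ | b <;> simp [ph]
  split_ifs <;> simp

lemma ph_01 [DecidableEq D] (i : D) (x : H D) : ph i x = 0 ∨ ph i x = 1 := by
  rcases x with ⟨j, s⟩ | b <;> simp [ph]
  tauto

lemma ph_same [DecidableEq D] {i : D} {x y : H D} (hx : ph i x ≠ 0) (hy : ph i y ≠ 0) :
    y = x ∨ y = op x := by
  rcases x with ⟨j, s⟩ | b <;> rcases y with ⟨k, t⟩ | c <;> simp [ph, op] at *
  subst hx; subst hy
  cases s <;> cases t <;> simp

lemma ph_mul [DecidableEq D] (i : D) {x y : H D} (h1 : y ≠ x) (h2 : y ≠ op x) :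
    ph i x * ph i y = 0 := by
  by_contra h
  rw [mul_eq_zero, not_or] at h
  rcases ph_same h.1 h.2 with h | h <;> contradiction

lemma ph_label [DecidableEq D] {i j : D} {x : H D} (hx : ph i x ≠ 0) (hy : ph j x ≠ 0) : i = j := by
  rcases x with ⟨k, s⟩ | b <;> simp [ph] at *
  rw [← hx, hy]

lemma ph_ne_op [DecidableEq D] {i : D} {x : H D} (hx : ph i x ≠ 0) : op x ≠ x := by
  rcases x with ⟨k, s⟩ | b <;> simp [ph, op] at *

/-- A triangulation of an annulus with coloured boundary segments. -/
structure Tri (D : Type) (ε : D → ℤ) where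
  t : H D → H D
  c : H D → ℤ
  r : H D → ℚ
  t3 : ∀ x, t (t (t x)) = x
  tne : ∀ x, t x ≠ x
  c1 : ∀ x, c x = 1 ∨ c x = -1
  cb : ∀ i, c (Sum.inr i) = ε i
  cop : ∀ x, c (op x) = c (t x)
  rop : ∀ x, op x ≠ x → r (op x) < r (t x)

variable [DecidableEq D] [Fintype D] {ε : D → ℤ}

def Tri.M (T : Tri D ε) (i j : D) : ℤ := ∑ x, ph i x * ph j (T.t x)

def Tri.B (T : Tri D ε) : Matrix D D ℤ := Matrix.of fun i j => T.M i j - T.M j i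

lemma Tri.inj (T : Tri D ε) {x y : H D} (h : T.t x = T.t y) : x = y := by
  rw [← T.t3 x, h, T.t3]

def Tri.eqv (T : Tri D ε) : H D ≃ H D where
  toFun := T.t
  invFun x := T.t (T.t x)
  left_inv := T.t3
  right_inv := T.t3

lemma Tri.sum_t (T : Tri D ε) (f : H D → ℤ) : ∑ x, f (T.t x) = ∑ x, f x :=
  Equiv.sum_comp T.eqv f

lemma Tri.t_ne_op (T : Tri D ε) (x : H D) : T.t x ≠ op x := by
  intro h
  by_cases h' : op x = x
  · exact T.tne x (h.trans h')
  · have := T.rop x h'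
    rw [h] at this
    exact lt_irrefl _ this

lemma Tri.t_t_ne (T : Tri D ε) (x : H D) : T.t (T.t x) ≠ x := by
  intro h
  have := T.t3 x
  rw [h] at this
  exact T.tne x this

lemma Tri.t_t_ne_op (T : Tri D ε) (x : H D) : T.t (T.t x) ≠ op x := by
  intro h
  have h2 : T.t (op x) = x := by rw [← h, T.t3]
  apply T.t_ne_op (op x)
  rw [h2, op_op]

/-- no two triangles glued around a puncture of degree two -/
lemma Tri.no_two (T : Tri D ε) (x : H D) (hx : op x ≠ x) (hz : op (T.t x) ≠ T.t x) :
    T.t (op (T.t x)) ≠ op x := by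
  intro h
  have h1 := T.rop x hx
  have h2 := T.rop (op (T.t x)) (by rw [op_op]; exact hz.symm)
  rw [h, op_op] at h2
  exact lt_asymm h1 h2

lemma Tri.nocancel (T : Tri D ε) (i j : D) : T.M i j = 0 ∨ T.M j i = 0 := by
  by_contra h
  rw [not_or] at h
  obtain ⟨x, -, hx⟩ := Finset.exists_ne_zero_of_sum_ne_zero h.1
  obtain ⟨y, -, hy⟩ := Finset.exists_ne_zero_of_sum_ne_zero h.2
  rw [mul_ne_zero_iff] at hx hy
  have e1 := ph_same hx.1 hy.2
  have e2 := ph_same hx.2 hy.1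
  have n1 := ph_ne_op hx.1
  have n2 := ph_ne_op hx.2
  rcases e2 with rfl | rfl
  · rcases e1 with e | e
    · exact T.t_t_ne x e
    · exact T.t_t_ne_op x e
  · rcases e1 with e | e
    · have h1 : T.t x = T.t (T.t (op (T.t x))) := by rw [e]
      have := T.t_t_ne_op (op (T.t x))
      rw [op_op] at this
      exact this h1.symm
    · exact T.no_two x n1 n2 e

lemma Tri.M_nonneg (T : Tri D ε) (i j : D) : 0 ≤ T.M i j :=
  Finset.sum_nonneg fun x _ => mul_nonneg (ph_nonneg _ _) (ph_nonneg _ _)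

lemma max_pair {u v : ℤ} (hu : 0 ≤ u) (hv : 0 ≤ v) (h : u = 0 ∨ v = 0) :
    max (u - v) 0 = u ∧ max (-(u - v)) 0 = v := by
  rcases h with rfl | rfl <;> simp [hu, hv]

lemma Tri.M_left (T : Tri D ε) (k j : D) :
    T.M k j = ph j (T.t (Sum.inl (k, true))) + ph j (T.t (Sum.inl (k, false))) := by
  unfold Tri.M
  rw [Fintype.sum_sum_type, Fintype.sum_prod_type]
  simp [ph]

lemma Tri.M_right (T : Tri D ε) (i k : D) :
    T.M i k = ph i (T.t (T.t (Sum.inl (k, true)))) + ph i (T.t (T.t (Sum.inl (k, false)))) := by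
  unfold Tri.M
  rw [← T.sum_t, ← T.sum_t]
  simp only [T.t3]
  rw [Fintype.sum_sum_type, Fintype.sum_prod_type]
  simp [ph]

lemma exists_between' (P : Prop) (a b : ℚ) (h : P → a < b) : ∃ q, (P → a < q) ∧ q < b := by
  by_cases hp : P
  · obtain ⟨q, h1, h2⟩ := exists_between (h hp)
    exact ⟨q, fun _ => h1, h2⟩
  · exact ⟨b - 1, fun h => absurd h hp, by linarith⟩

set_option maxHeartbeats 4000000 in
lemma Tri.flip (T : Tri D ε) (k : D) : ∃ T' : Tri D ε, T'.B = mutate T.B k := by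
  obtain ⟨h, hh⟩ : ∃ h : H D, h = Sum.inl (k, true) := ⟨_, rfl⟩
  obtain ⟨g, hg⟩ : ∃ g : H D, g = Sum.inl (k, false) := ⟨_, rfl⟩
  have oph : op h = g := by rw [hh, hg]; rfl
  have opg : op g = h := by rw [hh, hg]; rfl
  have hgne : h ≠ g := by rw [hh, hg]; simp
  obtain ⟨a, ha⟩ : ∃ a, a = T.t h := ⟨_, rfl⟩
  obtain ⟨b, hb⟩ : ∃ b, b = T.t a := ⟨_, rfl⟩
  obtain ⟨d, hd⟩ : ∃ d, d = T.t g := ⟨_, rfl⟩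
  obtain ⟨e, he⟩ : ∃ e, e = T.t d := ⟨_, rfl⟩
  have tb : T.t b = h := by rw [hb, ha, T.t3]
  have te : T.t e = g := by rw [he, hd, T.t3]
  have n1 : a ≠ h := by rw [ha]; exact T.tne h
  have n2 : a ≠ g := by rw [ha, ← oph]; exact T.t_ne_op h
  have n3 : b ≠ h := by rw [hb, ha]; exact T.t_t_ne h
  have n4 : b ≠ g := by rw [hb, ha, ← oph]; exact T.t_t_ne_op h
  have n5 : d ≠ g := by rw [hd]; exact T.tne g
  have n6 : d ≠ h := by rw [hd, ← opg]; exact T.t_ne_op g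
  have n7 : e ≠ g := by rw [he, hd]; exact T.t_t_ne g
  have n8 : e ≠ h := by rw [he, hd, ← opg]; exact T.t_t_ne_op g
  have n9 : a ≠ b := by rw [hb]; exact (T.tne a).symm
  have n10 : d ≠ e := by rw [he]; exact (T.tne d).symm
  have n11 : a ≠ d := by rw [ha, hd]; exact fun h' => hgne (T.inj h')
  have n12 : b ≠ e := by rw [hb, he]; exact fun h' => n11 (T.inj h')
  have n13 : a ≠ e := fun h' => n4 (by rw [hb, h', te])
  have n14 : b ≠ d := fun h' => n8 (by rw [he, ← h', tb])
  -- opposite facts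
  have o1 : b ≠ op a := by rw [hb]; exact T.t_ne_op a
  have o2 : e ≠ op d := by rw [he]; exact T.t_ne_op d
  have sixne : ∀ x, T.t x ∈ ({h, a, b, g, d, e} : Finset (H D)) →
      x ∈ ({h, a, b, g, d, e} : Finset (H D)) := by
    intro x hx
    simp only [Finset.mem_insert, Finset.mem_singleton] at hx ⊢
    rcases hx with hx | hx | hx | hx | hx | hx
    · right; right; left; exact T.inj (hx.trans tb.symm)
    · left; exact T.inj (hx.trans ha)
    · right; left; exact T.inj (hx.trans hb)
    · right; right; right; right; right; exact T.inj (hx.trans te.symm)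
    · right; right; right; left; exact T.inj (hx.trans hd)
    · right; right; right; right; left; exact T.inj (hx.trans he)
  obtain ⟨t', th, tga, tgb, tgg, tgd, tge, tout⟩ : ∃ t' : H D → H D, t' h = b ∧ t' a = g ∧ t' b = d ∧
      t' g = e ∧ t' d = h ∧ t' e = a ∧
      ∀ x, x ∉ ({h, a, b, g, d, e} : Finset (H D)) → t' x = T.t x := by
    refine ⟨fun x => if x = h then b else if x = a then g else if x = b then d else
      if x = g then e else if x = d then h else if x = e then a else T.t x, ?_, ?_, ?_, ?_, ?_, ?_, ?_⟩
    · simp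
    · simp [n1]
    · simp [n3, n9.symm]
    · simp [hgne.symm, n2.symm, n4.symm]
    · simp [n6, n11.symm, n14.symm, n5]
    · simp [n8, n13.symm, n12.symm, n7, n10.symm]
    · intro x hx
      simp only [Finset.mem_insert, Finset.mem_singleton, not_or] at hx
      simp [hx]
  have six : ∀ x, (x = h ∨ x = a ∨ x = b ∨ x = g ∨ x = d ∨ x = e) ∨
      x ∉ ({h, a, b, g, d, e} : Finset (H D)) := by
    intro x
    simp only [Finset.mem_insert, Finset.mem_singleton]
    tauto
  -- ranks
  have rad : op b ≠ b → T.r (op b) < T.r d := fun hb' => by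
    have h1 := T.rop b hb'
    have h2 := T.rop g (by rw [opg]; exact hgne)
    rw [tb] at h1
    rw [opg, ← hd] at h2
    exact h1.trans h2
  have rae : op e ≠ e → T.r (op e) < T.r a := fun he' => by
    have h1 := T.rop e he'
    have h2 := T.rop h (by rw [oph]; exact hgne.symm)
    rw [te] at h1
    rw [oph, ← ha] at h2
    exact h1.trans h2
  have o3 : d ≠ op b := fun h' => by
    have := rad (by rw [← h']; exact n14.symm)
    rw [← h'] at this; exact lt_irrefl _ this
  have o4 : a ≠ op e := fun h' => by
    have := rae (by rw [← h']; exact n13)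
    rw [← h'] at this; exact lt_irrefl _ this
  obtain ⟨qh, qh1, qh2⟩ := exists_between' (op d ≠ d) (T.r (op d)) (T.r e) (by
    rw [he]; exact T.rop d)
  obtain ⟨qg, qg1, qg2⟩ := exists_between' (op a ≠ a) (T.r (op a)) (T.r b) (by
    rw [hb]; exact T.rop a)
  obtain ⟨r', rh, rg, rout⟩ : ∃ r' : H D → ℚ, r' h = qh ∧ r' g = qg ∧
      ∀ x, x ≠ h → x ≠ g → r' x = T.r x :=
    ⟨fun x => if x = h then qh else if x = g then qg else T.r x, by simp, by simp [hgne.symm],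
      fun x h1 h2 => by simp [h1, h2]⟩
  obtain ⟨c', ch, cg, cout⟩ : ∃ c' : H D → ℤ, c' h = T.c e ∧ c' g = T.c b ∧
      ∀ x, x ≠ h → x ≠ g → c' x = T.c x :=
    ⟨fun x => if x = h then T.c e else if x = g then T.c b else T.c x, by simp,
      by simp [hgne.symm], fun x h1 h2 => by simp [h1, h2]⟩
  have opne : ∀ x, x ≠ h → x ≠ g → op x ≠ h ∧ op x ≠ g := by
    intro x h1 h2
    constructor
    · intro h3; apply h2; rw [← oph, ← h3, op_op]
    · intro h3; apply h1; rw [← opg, ← h3, op_op]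
  have outne : ∀ x, x ∉ ({h, a, b, g, d, e} : Finset (H D)) →
      x ≠ h ∧ x ≠ g ∧ T.t x ≠ h ∧ T.t x ≠ g := by
    intro x hx
    have := fun h' => hx (sixne x h')
    simp only [Finset.mem_insert, Finset.mem_singleton, not_or] at hx this
    tauto
  let T' : Tri D ε :=
    { t := t'
      c := c'
      r := r'
      t3 := by
        intro x
        rcases six x with (rfl | rfl | rfl | rfl | rfl | rfl) | hx
        · rw [th, tgb, tgd]
        · rw [tga, tgg, tge]
        · rw [tgb, tgd, th]
        · rw [tgg, tge, tga]
        · rw [tgd, th, tgb]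
        · rw [tge, tga, tgg]
        · have h1 := fun h' => hx (sixne x h')
          have h2 := fun h' => h1 (sixne _ h')
          rw [tout x hx, tout _ h1, tout _ h2, T.t3]
      tne := by
        intro x
        rcases six x with (rfl | rfl | rfl | rfl | rfl | rfl) | hx
        · rwa [th]
        · rw [tga]; exact n2.symm
        · rw [tgb]; exact n14.symm
        · rwa [tgg]
        · rw [tgd]; exact n6.symm
        · rwa [tge]
        · rw [tout x hx]; exact T.tne x
      c1 := by
        intro x
        by_cases h1 : x = h
        · rw [h1, ch]; exact T.c1 _
        by_cases h2 : x = g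
        · rw [h2, cg]; exact T.c1 _
        rw [cout x h1 h2]; exact T.c1 _
      cb := by
        intro i
        rw [cout _ (by rw [hh]; simp) (by rw [hg]; simp), T.cb]
      cop := by
        intro x
        rcases six x with (rfl | rfl | rfl | rfl | rfl | rfl) | hx
        · rw [oph, cg, th, cout _ n3 n4]
        · rw [tga, cg, cout _ (opne _ n1 n2).1 (opne _ n1 n2).2, T.cop, hb]
        · rw [tgb, cout _ (opne _ n3 n4).1 (opne _ n3 n4).2, T.cop, cout _ n6 n5, tb, hd,
            ← T.cop, opg]
        · rw [opg, ch, tgg, cout _ n8 n7]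
        · rw [tgd, ch, cout _ (opne _ n6 n5).1 (opne _ n6 n5).2, T.cop, he]
        · rw [tge, cout _ (opne _ n8 n7).1 (opne _ n8 n7).2, T.cop, cout _ n1 n2, te, ha,
            ← T.cop, oph]
        · obtain ⟨u1, u2, u3, u4⟩ := outne x hx
          rw [tout x hx, cout _ u3 u4, cout _ (opne _ u1 u2).1 (opne _ u1 u2).2, T.cop]
      rop := by
        intro x hopx
        rcases six x with (rfl | rfl | rfl | rfl | rfl | rfl) | hx
        · rw [oph, rg, th, rout _ n3 n4]; exact qg2
        · rw [tga, rg, rout _ (opne _ n1 n2).1 (opne _ n1 n2).2]; exact qg1 hopx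
        · rw [tgb, rout _ (opne _ n3 n4).1 (opne _ n3 n4).2, rout _ n6 n5]; exact rad hopx
        · rw [opg, rh, tgg, rout _ n8 n7]; exact qh2
        · rw [tgd, rh, rout _ (opne _ n6 n5).1 (opne _ n6 n5).2]; exact qh1 hopx
        · rw [tge, rout _ (opne _ n8 n7).1 (opne _ n8 n7).2, rout _ n1 n2]; exact rae hopx
        · obtain ⟨u1, u2, u3, u4⟩ := outne x hx
          rw [tout x hx, rout _ u3 u4, rout _ (opne _ u1 u2).1 (opne _ u1 u2).2]
          exact T.rop x hopx }
  refine ⟨T', ?_⟩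
  have diff : ∀ i j, T'.M i j = T.M i j + (ph i h * (ph j b - ph j a) + ph i a * (ph j g - ph j b)
      + ph i b * (ph j d - ph j h) + ph i g * (ph j e - ph j d) + ph i d * (ph j h - ph j e)
      + ph i e * (ph j a - ph j g)) := by
    intro i j
    rw [← sub_eq_iff_eq_add']
    unfold Tri.M
    rw [← Finset.sum_sub_distrib]
    rw [← Finset.sum_subset (Finset.subset_univ ({h, a, b, g, d, e} : Finset (H D)))]
    · rw [Finset.sum_insert, Finset.sum_insert, Finset.sum_insert, Finset.sum_insert,
        Finset.sum_insert, Finset.sum_singleton]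
      · change ph i h * ph j (t' h) - _ + (ph i a * ph j (t' a) - _ + (ph i b * ph j (t' b) - _ +
          (ph i g * ph j (t' g) - _ + (ph i d * ph j (t' d) - _ + (ph i e * ph j (t' e) - _))))) = _
        rw [th, tga, tgb, tgg, tgd, tge, ← ha, ← hb, tb, ← hd, ← he, te]
        ring
      · simp [n10]
      · simp [n5.symm, n7.symm]
      · simp [n4, n14, n12]
      · simp [n9, n2, n11, n13]
      · simp [n1.symm, n3.symm, hgne, n6.symm, n8.symm]
    · intro x _ hx
      change ph i x * ph j (t' x) - _ = 0
      rw [tout x hx, sub_self]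
  have phh : ∀ i, ph i g = ph i h := fun i => by rw [← oph, ph_op]
  have Mkj : ∀ j, T.M k j = ph j a + ph j d := fun j => by
    rw [T.M_left, ← hh, ← hg, ← ha, ← hd]
  have Mik : ∀ i, T.M i k = ph i b + ph i e := fun i => by
    rw [T.M_right, ← hh, ← hg, ← ha, ← hd, ← hb, ← he]
  have phk : ph k h = 1 := by rw [hh]; simp [ph]
  have phk0 : ∀ x, x ≠ h → x ≠ g → ph k x = 0 := by
    intro x h1 h2
    have := ph_mul k h1 (by rwa [oph])
    rwa [phk, one_mul] at this
  have phik : ∀ i, i ≠ k → ph i h = 0 := by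
    intro i hi; rw [hh]; simp [ph, hi.symm]
  have pa := phk0 a n1 n2
  have pb := phk0 b n3 n4
  have pd := phk0 d n6 n5
  have pe := phk0 e n8 n7
  ext i j
  simp only [mutate, Tri.B, Matrix.of_apply]
  by_cases hik : i = k
  · subst hik
    rw [if_pos (Or.inl rfl), diff, diff, Mkj, Mik, phh, phh, phk, pa, pb, pd, pe]
    ring
  by_cases hjk : j = k
  · subst hjk
    rw [if_pos (Or.inr rfl), diff, diff, Mkj, Mik, phh, phh, phk, pa, pb, pd, pe]
    ring
  rw [if_neg (by tauto)]
  have mx := max_pair (T.M_nonneg i k) (T.M_nonneg k i) (T.nocancel i k)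
  have my := max_pair (T.M_nonneg k j) (T.M_nonneg j k) (T.nocancel k j)
  rw [mx.1, mx.2, my.1, my.2, diff, diff, Mkj, Mik, Mkj, Mik, phh, phh, phik i hik, phik j hjk]
  ring

end CycleMut

namespace CycleMut

/-! ### The initial triangulation -/

lemma val_step {n : ℕ} [NeZero n] (x : ZMod n) (h : x + 1 ≠ 0) : (x + 1).val = x.val + 1 := by
  have h1 : 1 < n ∨ n = 1 := by have := NeZero.pos n; omega
  rcases h1 with h1 | h1
  · have : Fact (1 < n) := ⟨h1⟩
    have hx := x.val_lt
    have : x.val + 1 ≠ n := by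
      intro h'
      apply h
      have : ((x.val + 1 : ℕ) : ZMod n) = 0 := by rw [h']; simp
      rw [← this]; simp
    rw [ZMod.val_add_of_lt]
    · rw [ZMod.val_one]
    · rw [ZMod.val_one]; omega
  · subst h1; exact absurd (Subsingleton.elim _ _) h

def t0 {n : ℕ} (ε : ZMod n → ℤ) : H (ZMod n) → H (ZMod n)
  | Sum.inl (i, true) => if ε i = 1 then Sum.inl (i + 1, false) else Sum.inr i
  | Sum.inl (i, false) => if ε (i - 1) = 1 then Sum.inr (i - 1) else Sum.inl (i - 1, true)
  | Sum.inr i => if ε i = 1 then Sum.inl (i, true) else Sum.inl (i + 1, false)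

def c0 {n : ℕ} (ε : ZMod n → ℤ) : H (ZMod n) → ℤ
  | Sum.inl (_, true) => 1
  | Sum.inl (_, false) => -1
  | Sum.inr i => ε i

def r0 {n : ℕ} (i0 j0 : ZMod n) : H (ZMod n) → ℚ
  | Sum.inl (i, true) => - ((i - (j0 + 1)).val : ℚ)
  | Sum.inl (i, false) => ((i - (i0 + 1)).val : ℚ)
  | Sum.inr _ => n + 1

lemma exists_tri (n : ℕ) [NeZero n] (hn : 3 ≤ n) (ε : ZMod n → ℤ)
    (hε : ∀ i, ε i = 1 ∨ ε i = -1) (i0 j0 : ZMod n) (hi : ε i0 = -1) (hj : ε j0 = 1) :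
    ∃ T : Tri (ZMod n) ε, T.B = cycleMatrix n ε := by
  have h2 := two_ne n hn
  have h1 := one_ne n hn
  let T : Tri (ZMod n) ε :=
    { t := t0 ε
      c := c0 ε
      r := r0 i0 j0
      t3 := by
        rintro (⟨i, s⟩ | i)
        · cases s
          · by_cases h : ε (i - 1) = 1 <;> simp [t0, h]
          · by_cases h : ε i = 1 <;> simp [t0, h]
        · by_cases h : ε i = 1 <;> simp [t0, h]
      tne := by
        rintro (⟨i, s⟩ | i)
        · cases s
          · by_cases h : ε (i - 1) = 1 <;> simp [t0, h]
          · by_cases h : ε i = 1 <;> simp [t0, h]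
        · by_cases h : ε i = 1 <;> simp [t0, h]
      c1 := by
        rintro (⟨i, s⟩ | i)
        · cases s <;> simp [c0]
        · exact hε i
      cb := fun i => rfl
      cop := by
        rintro (⟨i, s⟩ | i)
        · cases s
          · rcases hε (i - 1) with h | h <;> simp [t0, h, c0, op]
          · rcases hε i with h | h <;> simp [t0, h, c0, op]
        · rcases hε i with h | h <;> simp [t0, h, c0, op]
      rop := by
        have lt : ∀ x : ZMod n, (x.val : ℚ) < n + 1 := fun x => by
          have := x.val_lt
          have : (x.val : ℚ) < n := by exact_mod_cast this
          linarith
        rintro (⟨i, s⟩ | i) hx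
        · cases s
          · rcases hε (i - 1) with h | h
            · simp only [op, t0, r0, h, Bool.not_false, if_true]
              have : (0 : ℚ) ≤ ((i - (j0 + 1)).val : ℚ) := by positivity
              have : (0 : ℚ) ≤ (n : ℚ) := by positivity
              linarith
            · have hne : i - 1 - (j0 + 1) + 1 ≠ 0 := by
                intro h'
                have : i - 1 = j0 := by linear_combination h'
                rw [this, hj] at h
                norm_num at h
              have := val_step _ hne
              rw [show i - 1 - (j0 + 1) + 1 = i - (j0 + 1) by ring] at this
              simp [op, t0, r0, h, -ZMod.natCast_val]
              rw [this]; push_cast; linarith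
          · rcases hε i with h | h
            · have hne : i - (i0 + 1) + 1 ≠ 0 := by
                intro h'
                have : i = i0 := by linear_combination h'
                rw [this, hi] at h
                norm_num at h
              have := val_step _ hne
              rw [show i - (i0 + 1) + 1 = i + 1 - (i0 + 1) by ring] at this
              simp only [op, t0, r0, h, Bool.not_true, if_true]
              rw [this]; push_cast; linarith
            · simp [op, t0, r0, h, -ZMod.natCast_val]
              exact lt _
        · exact absurd rfl hx }
  refine ⟨T, ?_⟩
  ext k j
  simp only [Tri.B, Matrix.of_apply, T.M_left]
  have tT : T.t = t0 ε := rfl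
  simp only [tT]
  have P1 : ∀ k j, ph j (t0 ε (Sum.inl (k, true))) = if ε k = 1 ∧ j = k + 1 then 1 else 0 := by
    intro k j
    by_cases h : ε k = 1 <;> simp [t0, h, ph, eq_comm]
  have P2 : ∀ k j, ph j (t0 ε (Sum.inl (k, false))) = if ε j = -1 ∧ k = j + 1 then 1 else 0 := by
    intro k j
    have : k - 1 = j ↔ k = j + 1 := sub_eq_iff_eq_add
    by_cases h : ε (k - 1) = 1
    · simp [t0, h, ph]
      rintro h' rfl
      simp at h
      rw [h'] at h; norm_num at h
    · have h' : ε (k - 1) = -1 := by have := hε (k - 1); tauto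
      simp only [t0, h, ph, if_false, this]
      by_cases e : k = j + 1
      · subst e
        simp at h'
        simp [h']
      · simp [e]
  rw [P1, P2, P1, P2]
  simp only [cycleMatrix, Matrix.of_apply]
  have hk := hε k
  have hj' := hε j
  have e2 : j = k + 1 → ¬ k = j + 1 := fun e1 h => h2 (by rw [e1] at h; linear_combination -h)
  clear P1 P2 tT T
  clear hε h1 h2
  grind

/-! ### Reading off the numbers -/

def be {D : Type} : H D → ℤ
  | Sum.inl _ => 0
  | Sum.inr _ => 1

lemma be_01 {D : Type} (x : H D) : be x = 0 ∨ be x = 1 := by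
  rcases x with x | x <;> simp [be]

lemma sum_ph {D : Type} [DecidableEq D] [Fintype D] (x : H D) : ∑ i, ph i x = 1 - be x := by
  rcases x with ⟨x, s⟩ | x <;> simp [be, ph]

lemma sum_be {D : Type} [DecidableEq D] [Fintype D] :
    ∑ x : H D, be x = Fintype.card D := by
  rw [Fintype.sum_sum_type]; simp [be]

section
variable {D : Type} [DecidableEq D] [Fintype D] {ε : D → ℤ}

lemma Tri.sum_M (T : Tri D ε) : ∑ i, ∑ j, T.M i j =
    Fintype.card D + ∑ x, be x * be (T.t x) := by
  have : ∑ i, ∑ j, T.M i j = ∑ x, (1 - be x) * (1 - be (T.t x)) := by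
    unfold Tri.M
    rw [Finset.sum_comm]
    rw [Finset.sum_congr rfl (fun _ _ => Finset.sum_comm), Finset.sum_comm]
    refine Finset.sum_congr rfl fun x _ => ?_
    simp only [← Finset.sum_mul, ← Finset.mul_sum, sum_ph]
  rw [this]
  have e : ∀ x, (1 - be x) * (1 - be (T.t x)) = 1 - be x - be (T.t x) + be x * be (T.t x) := by
    intro x; ring
  simp only [e, Finset.sum_add_distrib, Finset.sum_sub_distrib]
  rw [T.sum_t be, sum_be]
  simp
  ring

lemma Tri.be1 (T : Tri D ε) (h : ∑ i, ∑ j, T.M i j = Fintype.card D) (x : H D) :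
    be x * be (T.t x) = 0 := by
  rw [T.sum_M] at h
  have h0 : ∑ x, be x * be (T.t x) = 0 := by linarith
  rw [Finset.sum_eq_zero_iff_of_nonneg] at h0
  · exact h0 x (Finset.mem_univ _)
  · intro x _
    rcases be_01 x with h | h <;> rcases be_01 (T.t x) with h' | h' <;> simp [h, h']

lemma Tri.be2 (T : Tri D ε) (h : ∑ i, ∑ j, T.M i j = Fintype.card D) (x : H D) :
    (1 - be x) * (1 - be (T.t x)) * (1 - be (T.t (T.t x))) = 0 := by
  have h1 := T.be1 h
  have h0 : ∑ x, (1 - be x) * (1 - be (T.t x)) * (1 - be (T.t (T.t x))) = 0 := by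
    have e : ∀ x, (1 - be x) * (1 - be (T.t x)) * (1 - be (T.t (T.t x))) =
        1 - be x - be (T.t x) - be (T.t (T.t x)) := by
      intro x
      have a := h1 x
      have b := h1 (T.t x)
      have c := h1 (T.t (T.t x))
      rw [T.t3] at c
      linear_combination (1 - be (T.t (T.t x))) * a + b + c
    simp only [e, Finset.sum_sub_distrib]
    rw [T.sum_t (fun x => be (T.t x)), T.sum_t be, sum_be]
    simp
    ring
  rw [Finset.sum_eq_zero_iff_of_nonneg] at h0
  · exact h0 x (Finset.mem_univ _)
  · intro x _
    rcases be_01 x with h | h <;> rcases be_01 (T.t x) with h' | h' <;>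
      rcases be_01 (T.t (T.t x)) with h'' | h'' <;> simp [h, h', h'']

lemma be_ph {i : D} {x : H D} (h : ph i x ≠ 0) : be x = 0 := by
  rcases x with x | x <;> simp [be, ph] at *

/-- an arrow comes from a triangle with a boundary side -/
lemma Tri.exists_bd (T : Tri D ε) (h : ∑ i, ∑ j, T.M i j = Fintype.card D) {i j : D}
    (hM : T.M i j ≠ 0) : ∃ b : D, ph i (T.t (Sum.inr b)) ≠ 0 ∧ ph j (T.t (T.t (Sum.inr b))) ≠ 0 := by
  obtain ⟨x, -, hx⟩ := Finset.exists_ne_zero_of_sum_ne_zero hM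
  rw [mul_ne_zero_iff] at hx
  have := T.be2 h x
  rw [be_ph hx.1, be_ph hx.2] at this
  rcases hy : T.t (T.t x) with y | b
  · rw [hy] at this; simp [be] at this
  · refine ⟨b, ?_, ?_⟩
    · rw [← hy, T.t3]; exact hx.1
    · rw [← hy, T.t3]; exact hx.2

lemma Tri.M_pos (T : Tri D ε) {i j : D} (h : 0 < T.M i j - T.M j i) : T.M i j ≠ 0 := by
  have := T.M_nonneg j i
  omega

end

lemma sum_cycle (n : ℕ) [NeZero n] (hn : 3 ≤ n) (ε : ZMod n → ℤ)
    (hε : ∀ i, ε i = 1 ∨ ε i = -1) : ∑ l, ∑ m, |cycleMatrix n ε l m| = 2 * n := by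
  have h2 := two_ne n hn
  have : ∀ l m, |cycleMatrix n ε l m| = (if m = l + 1 then 1 else 0) + (if m = l - 1 then 1 else 0) := by
    intro l m
    have e : l = m + 1 ↔ m = l - 1 := by rw [eq_sub_iff_add_eq, eq_comm]
    simp only [cycleMatrix, Matrix.of_apply]
    by_cases h1 : m = l + 1
    · have : ¬ (m = l - 1) := fun h => h2 (by rw [h1] at h; linear_combination h)
      rw [if_pos h1, if_pos h1, if_neg this]
      rcases hε l with h | h <;> simp [h]
    · rw [if_neg h1, if_neg h1]
      by_cases h3 : m = l - 1
      · rw [if_pos (e.2 h3), if_pos h3]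
        rcases hε m with h | h <;> simp [h]
      · rw [if_neg (fun h => h3 (e.1 h)), if_neg h3]; simp
  simp only [this, Finset.sum_add_distrib]
  simp
  ring

lemma Tri.total (n : ℕ) [NeZero n] (hn : 3 ≤ n) (ε ε' : ZMod n → ℤ)
    (hε' : ∀ i, ε' i = 1 ∨ ε' i = -1) (T : Tri (ZMod n) ε) (g : Equiv.Perm (ZMod n))
    (hB : ∀ l m, T.M (g l) (g m) - T.M (g m) (g l) = cycleMatrix n ε' l m) :
    ∑ i, ∑ j, T.M i j = Fintype.card (ZMod n) := by
  have h := sum_cycle n hn ε' hε'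
  have e : ∀ l m, |cycleMatrix n ε' l m| = T.M (g l) (g m) + T.M (g m) (g l) := by
    intro l m
    rw [← hB]
    have h1 := T.M_nonneg (g l) (g m)
    have h2 := T.M_nonneg (g m) (g l)
    rcases T.nocancel (g l) (g m) with h | h
    · rw [h, zero_sub, abs_neg, abs_of_nonneg h2, zero_add]
    · rw [h, sub_zero, abs_of_nonneg h1, add_zero]
  simp only [e, Finset.sum_add_distrib] at h
  rw [Finset.sum_comm (f := fun l m => T.M (g m) (g l))] at h
  have e2 : ∑ l, ∑ m, T.M (g l) (g m) = ∑ i, ∑ j, T.M i j := by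
    rw [← Equiv.sum_comp g (fun i => ∑ j, T.M i j)]
    refine Finset.sum_congr rfl fun l _ => ?_
    rw [← Equiv.sum_comp g (fun j => T.M (g l) j)]
  rw [e2] at h
  rw [ZMod.card]
  linarith

end CycleMut

namespace CycleMut

lemma zmod_const {n : ℕ} [NeZero n] {α : Type*} (f : ZMod n → α) (h : ∀ l, f (l + 1) = f l)
    (l : ZMod n) : f l = f 0 := by
  have : ∀ m : ℕ, f (m : ZMod n) = f 0 := by
    intro m
    induction m with
    | zero => simp
    | succ m ih => rw [Nat.cast_succ, h, ih]
  rw [← ZMod.natCast_zmod_val l]; exact this _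

set_option maxHeartbeats 1000000 in
lemma readoff (n : ℕ) [NeZero n] (hn : 3 ≤ n) (ε ε' : ZMod n → ℤ)
    (hε' : ∀ i, ε' i = 1 ∨ ε' i = -1)
    (i0 j0 : ZMod n) (hi : ε i0 = -1) (hj : ε j0 = 1)
    (T : Tri (ZMod n) ε) (g : Equiv.Perm (ZMod n))
    (hB : ∀ l m, T.M (g l) (g m) - T.M (g m) (g l) = cycleMatrix n ε' l m) :
    ∃ θ : Equiv.Perm (ZMod n), (∀ l, ε' l = ε (θ l)) ∨ (∀ l, ε' l = - ε (θ l)) := by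
  have h2 := two_ne n hn
  have h1 := one_ne n hn
  have tot := T.total n hn ε ε' hε' g hB
  have be1 := T.be1 tot
  have ex : ∀ l, ∃ b, (ε' l = 1 ∧ ph (g l) (T.t (Sum.inr b)) ≠ 0 ∧
        ph (g (l + 1)) (T.t (T.t (Sum.inr b))) ≠ 0) ∨
      (ε' l = -1 ∧ ph (g (l + 1)) (T.t (Sum.inr b)) ≠ 0 ∧
        ph (g l) (T.t (T.t (Sum.inr b))) ≠ 0) := by
    intro l
    have := hB l (l + 1)
    simp only [cycleMatrix, Matrix.of_apply, if_true] at this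
    rcases hε' l with h | h
    · obtain ⟨b, hb⟩ := T.exists_bd tot (T.M_pos (i := g l) (j := g (l + 1)) (by omega))
      exact ⟨b, Or.inl ⟨h, hb⟩⟩
    · obtain ⟨b, hb⟩ := T.exists_bd tot (T.M_pos (i := g (l + 1)) (j := g l) (by omega))
      exact ⟨b, Or.inr ⟨h, hb⟩⟩
  choose θ hθ using ex
  have lab : ∀ {l m : ZMod n} {x : H (ZMod n)}, ph (g l) x ≠ 0 → ph (g m) x ≠ 0 → l = m :=
    fun h h' => g.injective (ph_label h h')
  have θinj : Function.Injective θ := by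
    intro l m hlm
    have a := hθ l
    have b := hθ m
    rw [← hlm] at b
    rcases a with ⟨_, a1, a2⟩ | ⟨_, a1, a2⟩ <;> rcases b with ⟨_, b1, b2⟩ | ⟨_, b1, b2⟩
    · exact lab a1 b1
    · have e1 := lab a1 b1
      have e2 := lab a2 b2
      exact absurd (show (2 : ZMod n) = 0 by linear_combination e2 - e1) h2
    · have e1 := lab a1 b1
      have e2 := lab a2 b2
      exact absurd (show (2 : ZMod n) = 0 by linear_combination e1 - e2) h2
    · exact lab a2 b2
  have θbij : Function.Bijective θ := Finite.injective_iff_bijective.1 θinj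
  -- colours
  have cA : ∀ b, T.c (T.t (Sum.inr b)) = ε b := fun b => by
    rw [← T.cop, ← T.cb]; rfl
  have cB : ∀ b, T.c (op (T.t (Sum.inr b))) = T.c (T.t (T.t (Sum.inr b))) := fun b => T.cop _
  have cC : ∀ b, T.c (op (T.t (T.t (Sum.inr b)))) = ε b := fun b => by
    rw [T.cop, T.t3, T.cb]
  -- monochromatic diagonals
  let mono : ZMod n → Prop := fun l => ∀ x, ph (g l) x ≠ 0 → T.c (op x) = T.c x
  have mono_of : ∀ l x, ph (g l) x ≠ 0 → (mono l ↔ T.c (op x) = T.c x) := by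
    intro l x hx
    refine ⟨fun h => h x hx, fun h y hy => ?_⟩
    rcases ph_same hx hy with rfl | rfl
    · exact h
    · rw [op_op, h]
  have mono_step : ∀ l, mono (l + 1) = mono l := by
    intro l
    apply propext
    rcases hθ l with ⟨_, a1, a2⟩ | ⟨_, a1, a2⟩
    · rw [mono_of _ _ a1, mono_of _ _ a2, cB, cA, cC, eq_comm]
    · rw [mono_of _ _ a1, mono_of _ _ a2, cB, cA, cC, eq_comm]
  have notmono : ∀ l, ¬ mono l := by
    intro l hl
    have all : ∀ m, mono m := fun m => by
      rw [zmod_const mono mono_step m, ← zmod_const mono mono_step l]; exact hl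
    let col : ZMod n → ℤ := fun l => T.c (Sum.inl (g l, true))
    have col_of : ∀ l x, ph (g l) x ≠ 0 → T.c x = col l := by
      intro l x hx
      have h0 : ph (g l) (Sum.inl (g l, true)) ≠ 0 := by simp [ph]
      rcases ph_same h0 hx with rfl | rfl
      · rfl
      · exact all l _ h0
    have colstep : ∀ l, ε (θ l) = col l ∧ ε (θ l) = col (l + 1) := by
      intro l
      rcases hθ l with ⟨_, a1, a2⟩ | ⟨_, a1, a2⟩
      · rw [← col_of _ _ a1, ← col_of _ _ a2, cA, ← all _ _ a2, cC]; simp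
      · rw [← col_of _ _ a1, ← col_of _ _ a2, cA, ← all _ _ a2, cC]; simp
    have colc := zmod_const col (fun l => (colstep l).2.symm.trans (colstep l).1)
    obtain ⟨l1, hl1⟩ := θbij.2 i0
    obtain ⟨l2, hl2⟩ := θbij.2 j0
    have e1 := (colstep l1).1
    have e2 := (colstep l2).1
    rw [hl1, hi, colc] at e1
    rw [hl2, hj, colc] at e2
    rw [← e2] at e1
    norm_num at e1
  have cop_neg : ∀ l x, ph (g l) x ≠ 0 → T.c (op x) = - T.c x := by
    intro l x hx
    have := notmono l
    rw [mono_of l x hx] at this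
    rcases T.c1 x with h | h <;> rcases T.c1 (op x) with h' | h' <;> rw [h, h'] at this ⊢ <;> simp at this ⊢
  -- half-edges of diagonal `l + 1` in the triangles `θ l` and `θ (l + 1)`
  have ex1 : ∀ l, ∃ x, ph (g (l + 1)) x ≠ 0 ∧ T.c x = - (ε' l * ε (θ l)) ∧
      (x = T.t (Sum.inr (θ l)) ∨ x = T.t (T.t (Sum.inr (θ l)))) := by
    intro l
    rcases hθ l with ⟨h, a1, a2⟩ | ⟨h, a1, a2⟩
    · refine ⟨_, a2, ?_, Or.inr rfl⟩
      rw [← cC, cop_neg _ _ a2, h]; ring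
    · refine ⟨_, a1, ?_, Or.inl rfl⟩
      rw [cA, h]; ring
  have ex2 : ∀ l, ∃ x, ph (g l) x ≠ 0 ∧ T.c x = (ε' l * ε (θ l)) ∧
      (x = T.t (Sum.inr (θ l)) ∨ x = T.t (T.t (Sum.inr (θ l)))) := by
    intro l
    rcases hθ l with ⟨h, a1, a2⟩ | ⟨h, a1, a2⟩
    · refine ⟨_, a1, ?_, Or.inl rfl⟩
      rw [cA, h]; ring
    · refine ⟨_, a2, ?_, Or.inr rfl⟩
      rw [← cC, cop_neg _ _ a2, h]; ring
  have bb : ∀ b b' : ZMod n, T.t (Sum.inr b) ≠ Sum.inr b' := by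
    intro b b' h
    have := be1 (Sum.inr b)
    rw [h] at this
    simp [be] at this
  have tri_inj : ∀ (b b' : ZMod n) (x : H (ZMod n)),
      (x = T.t (Sum.inr b) ∨ x = T.t (T.t (Sum.inr b))) →
      (x = T.t (Sum.inr b') ∨ x = T.t (T.t (Sum.inr b'))) → b = b' := by
    intro b b' x h h'
    rcases h with h | h <;> rcases h' with h' | h'
    · exact Sum.inr_injective (T.inj (h.symm.trans h'))
    · exact absurd (T.inj (h'.symm.trans h)) (bb _ _)
    · exact absurd (T.inj (h.symm.trans h')) (bb _ _)
    · exact Sum.inr_injective (T.inj (T.inj (h.symm.trans h')))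
  have step : ∀ l, ε' (l + 1) * ε (θ (l + 1)) = ε' l * ε (θ l) := by
    intro l
    obtain ⟨x, x1, x2, x3⟩ := ex1 l
    obtain ⟨y, y1, y2, y3⟩ := ex2 (l + 1)
    rcases ph_same x1 y1 with rfl | rfl
    · have := θinj (tri_inj _ _ _ x3 y3)
      exact absurd (show (1 : ZMod n) = 0 by linear_combination -this) h1
    · rw [← y2, cop_neg _ _ x1, x2]; ring
  have cst := zmod_const (fun l => ε' l * ε (θ l)) step
  have sq : ∀ b, ε b = 1 ∨ ε b = -1 := fun b => by rw [← T.cb]; exact T.c1 _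
  refine ⟨Equiv.ofBijective θ θbij, ?_⟩
  have hc : ε' 0 * ε (θ 0) = 1 ∨ ε' 0 * ε (θ 0) = -1 := by
    rcases hε' 0 with h | h <;> rcases sq (θ 0) with h' | h' <;> simp [h, h']
  rcases hc with hc | hc
  · left
    intro l
    have := cst l
    simp only [hc] at this
    simp only [Equiv.ofBijective_apply]
    rcases hε' l with h | h <;> rcases sq (θ l) with h' | h' <;> simp [h, h'] at this ⊢
  · right
    intro l
    have := cst l
    simp only [hc] at this
    simp only [Equiv.ofBijective_apply]
    rcases hε' l with h | h <;> rcases sq (θ l) with h' | h' <;> simp [h, h'] at this ⊢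

lemma tri_of_mutEquiv {D : Type} [DecidableEq D] [Fintype D] {ε : D → ℤ} {B C : Matrix D D ℤ}
    (h : MutEquiv B C) (hB : ∃ T : Tri D ε, T.B = B) : ∃ T : Tri D ε, T.B = C := by
  unfold MutEquiv at h
  induction h with
  | refl => exact hB
  | tail _ hk ih =>
    obtain ⟨k, rfl⟩ := hk
    obtain ⟨T, rfl⟩ := ih
    exact T.flip k

lemma card_le' {n : ℕ} [NeZero n] (ε : ZMod n → ℤ) :
    (Finset.univ.filter fun i => ε i = 1).card ≤ n := by
  have := Finset.card_filter_le (Finset.univ : Finset (ZMod n)) (fun i => ε i = 1)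
  rwa [Finset.card_univ, ZMod.card] at this

lemma card_of_nonconst (n : ℕ) [NeZero n] (hn : 3 ≤ n) (ε ε' : ZMod n → ℤ)
    (hε : ∀ i, ε i = 1 ∨ ε i = -1) (hε' : ∀ i, ε' i = 1 ∨ ε' i = -1)
    (i0 j0 : ZMod n) (hi : ε i0 = -1) (hj : ε j0 = 1) (σ : Equiv.Perm (ZMod n))
    (h : MutEquiv (cycleMatrix n ε) ((cycleMatrix n ε').submatrix σ σ)) :
    (Finset.univ.filter fun i => ε i = 1).card = (Finset.univ.filter fun i => ε' i = 1).card ∨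
    (Finset.univ.filter fun i => ε i = 1).card =
      n - (Finset.univ.filter fun i => ε' i = 1).card := by
  obtain ⟨T, hT⟩ := tri_of_mutEquiv h (exists_tri n hn ε hε i0 j0 hi hj)
  obtain ⟨θ, hθ⟩ := readoff n hn ε ε' hε' i0 j0 hi hj T σ.symm (by
    intro l m
    have := congrFun (congrFun hT (σ.symm l)) (σ.symm m)
    simpa [Tri.B] using this)
  rw [← card_neg ε' hε']
  have cc : (Finset.univ.filter fun i => ε i = 1).card =
      (Finset.univ.filter fun i => ε (θ i) = 1).card := by
    apply Finset.card_bij' (fun i _ => θ.symm i) (fun i _ => θ i) <;> simp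
  rw [cc]
  rcases hθ with hθ | hθ
  · left
    simp only [hθ]
  · right
    simp only [hθ, neg_inj]

lemma exists_of_ne {n : ℕ} [NeZero n] (ε : ZMod n → ℤ) (hε : ∀ i, ε i = 1 ∨ ε i = -1)
    (h0 : (Finset.univ.filter fun i => ε i = 1).card ≠ 0)
    (h1 : (Finset.univ.filter fun i => ε i = 1).card ≠ n) :
    ∃ i0 j0, ε i0 = -1 ∧ ε j0 = 1 := by
  have hj : ∃ j, ε j = 1 := by
    by_contra h
    push Not at h
    apply h0
    simp [h]
  have hi : ∃ i, ε i = -1 := by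
    by_contra h
    push Not at h
    apply h1
    have : ∀ i, ε i = 1 := fun i => by have := hε i; have := h i; tauto
    simp [this]
  obtain ⟨i, hi⟩ := hi
  obtain ⟨j, hj⟩ := hj
  exact ⟨i, j, hi, hj⟩

lemma multiset_iff (n a b : ℕ) (ha : a ≤ n) (hb : b ≤ n) :
    ({a, n - a} : Multiset ℕ) = {b, n - b} ↔ a = b ∨ a = n - b := by
  constructor
  · intro h
    have : a ∈ ({b, n - b} : Multiset ℕ) := by rw [← h]; simp
    simpa using this
  · rintro (rfl | h)
    · rfl
    · have : n - a = b := by omega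
      rw [this, h]
      exact Multiset.pair_comm _ _

end CycleMut

/-- Two orientations of the `n`-cycle (`n ≥ 3`) give mutation equivalent matrices,
up to simultaneous relabeling of rows and columns, if and only if the unordered pairs
`{n₁, n₂}` of the numbers of edges in the two directions coincide. -/
theorem cycle_mutation_equiv_iff (n : ℕ) [NeZero n] (hn : 3 ≤ n)
    (ε ε' : ZMod n → ℤ)
    (hε : ∀ i, ε i = 1 ∨ ε i = -1) (hε' : ∀ i, ε' i = 1 ∨ ε' i = -1) :
    (∃ σ : Equiv.Perm (ZMod n),
        MutEquiv (cycleMatrix n ε) ((cycleMatrix n ε').submatrix σ σ)) ↔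
      ({(Finset.univ.filter fun i => ε i = 1).card,
          n - (Finset.univ.filter fun i => ε i = 1).card} : Multiset ℕ) =
        ({(Finset.univ.filter fun i => ε' i = 1).card,
          n - (Finset.univ.filter fun i => ε' i = 1).card} : Multiset ℕ) := by
  rw [CycleMut.multiset_iff n _ _ (CycleMut.card_le' ε) (CycleMut.card_le' ε')]
  constructor
  · rintro ⟨σ, h⟩
    by_cases hc : (Finset.univ.filter fun i => ε i = 1).card ≠ 0 ∧
        (Finset.univ.filter fun i => ε i = 1).card ≠ n
    · obtain ⟨i0, j0, hi, hj⟩ := CycleMut.exists_of_ne ε hε hc.1 hc.2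
      exact CycleMut.card_of_nonconst n hn ε ε' hε hε' i0 j0 hi hj σ h
    by_cases hc' : (Finset.univ.filter fun i => ε' i = 1).card ≠ 0 ∧
        (Finset.univ.filter fun i => ε' i = 1).card ≠ n
    · obtain ⟨i0, j0, hi, hj⟩ := CycleMut.exists_of_ne ε' hε' hc'.1 hc'.2
      have h' := CycleMut.MutEquiv.submatrix' (CycleMut.MutEquiv.symm' h) σ.symm
      have e : ((cycleMatrix n ε').submatrix σ σ).submatrix σ.symm σ.symm = cycleMatrix n ε' := by
        ext i j; simp
      rw [e] at h'
      have := CycleMut.card_of_nonconst n hn ε' ε hε' hε i0 j0 hi hj σ.symm h'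
      have := CycleMut.card_le' ε
      have := CycleMut.card_le' ε'
      omega
    · omega
  · rintro (h | h)
    · refine ⟨1, ?_⟩
      have := CycleMut.mutEquiv_of_card hn ε ε' hε hε' h
      simpa using this
    · exact CycleMut.exists_of_card' hn ε ε' hε hε' h
end

section
/- Let n ≥ 4 and let ε : ℤ/nℤ → {+1,−1} be the constant function +1, so that B_ε encodes the cyclically oriented n-cycle. Then B_ε is mutation equivalent to some skew-symmetric n×n integer matrix C whose entrywise absolute value is, after a simultaneous permutation of rows and columns, the adjacency matrix of the Dynkin diagram D_n; that is, the cyclically oriented n-cycle has type D_n. -/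
open Matrix

/-- The adjacency matrix of the Dynkin diagram `D n` (vertices `0, …, n-1`
corresponding to `1, …, n`; edges `{0,2}`, `{1,2}`, and `{i, i+1}` for `2 ≤ i ≤ n-2`). -/
def DnAdj (n : ℕ) : Matrix (Fin n) (Fin n) ℤ :=
  Matrix.of fun i j =>
    if ((i : ℕ) = 0 ∧ (j : ℕ) = 2) ∨ ((i : ℕ) = 2 ∧ (j : ℕ) = 0) ∨
       ((i : ℕ) = 1 ∧ (j : ℕ) = 2) ∨ ((i : ℕ) = 2 ∧ (j : ℕ) = 1) ∨
       (2 ≤ (i : ℕ) ∧ (j : ℕ) = (i : ℕ) + 1) ∨ (2 ≤ (j : ℕ) ∧ (i : ℕ) = (j : ℕ) + 1)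
    then 1 else 0

/-- Arrows of the quiver after mutating at `0, …, t-1`. -/
def arr (n t a b : ℕ) : ℤ :=
  if (b = a + 1 ∧ b ≠ t) ∨ (a + 1 = t ∧ b + 1 = n) ∨ (a = t ∧ b + 1 = t) ∨ (a + 1 = n ∧ b = t)
  then 1 else 0

def stg (n t a b : ℕ) : ℤ := arr n t a b - arr n t b a

lemma stg_col (n t a : ℕ) (ht : t + 3 ≤ n) :
    stg n t a t = (if a + 1 = n then 1 else 0) - (if a = t + 1 ∨ a + 1 = t then 1 else 0) := by
  unfold stg arr
  congr 1
  · apply if_congr _ rfl rfl; omega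
  · apply if_congr _ rfl rfl; omega

lemma stg_skew (n t a b : ℕ) : stg n t b a = - stg n t a b := by
  unfold stg; ring

lemma arr_eq (n t a b : ℕ) (P : Prop) [Decidable P]
    (h : ((b = a + 1 ∧ b ≠ t) ∨ (a + 1 = t ∧ b + 1 = n) ∨ (a = t ∧ b + 1 = t) ∨
      (a + 1 = n ∧ b = t)) ↔ P) : arr n t a b = if P then 1 else 0 := by
  unfold arr
  exact if_congr h rfl rfl

lemma step_row (n t a b : ℕ) (ht : t + 3 ≤ n) (hb : b < n) (ha : a = t) :
    stg n (t+1) a b = -(stg n t a b) := by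
  subst ha
  rw [← stg_skew, stg_col n a b ht]
  unfold stg
  rw [arr_eq n (a+1) a b (b + 1 = n) (by omega),
    arr_eq n (a+1) b a (b = a + 1 ∨ b + 1 = a) (by omega)]

lemma step_gen (n t a b : ℕ) (ht : t + 3 ≤ n) (ha : a + 1 ≠ n) (hb : b + 1 ≠ n)
    (h1 : a ≠ t) (h2 : b ≠ t) :
    stg n (t+1) a b = stg n t a b := by
  unfold stg
  rw [arr_eq n (t+1) a b (b = a + 1) (by omega), arr_eq n (t+1) b a (a = b + 1) (by omega),
    arr_eq n t a b (b = a + 1) (by omega), arr_eq n t b a (a = b + 1) (by omega)]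

lemma step_last (n t a b : ℕ) (ht : t + 3 ≤ n) (ha : a + 1 = n) (hb : b < n)
    (h2 : b ≠ t) :
    stg n (t+1) a b = stg n t a b + if b = t + 1 ∨ b + 1 = t then 1 else 0 := by
  unfold stg
  rw [arr_eq n (t+1) a b (b = t + 1) (by omega), arr_eq n (t+1) b a (b + 2 = n) (by omega),
    arr_eq n t a b (b = t) (by omega), arr_eq n t b a (b + 2 = n ∨ b + 1 = t) (by omega)]
  split_ifs <;> first | omega | norm_num

lemma step_eq (n t a b : ℕ) (ht : t + 3 ≤ n) (ha : a < n) (hb : b < n) :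
    stg n (t+1) a b = if a = t ∨ b = t then -(stg n t a b)
    else stg n t a b + max (stg n t a t) 0 * max (stg n t t b) 0
      - max (-(stg n t a t)) 0 * max (-(stg n t t b)) 0 := by
  by_cases h1 : a = t
  · rw [if_pos (Or.inl h1), step_row n t a b ht hb h1]
  by_cases h2 : b = t
  · rw [if_pos (Or.inr h2), stg_skew n (t+1) b a, step_row n t b a ht ha h2, stg_skew n t b a]
  rw [if_neg (by tauto), stg_skew n t b t, stg_col n t a ht, stg_col n t b ht]
  by_cases h3 : a + 1 = n
  · rw [step_last n t a b ht h3 hb h2, if_pos h3, if_neg (show ¬ (a = t + 1 ∨ a + 1 = t) by omega)]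
    by_cases h5 : b + 1 = n
    · rw [if_pos h5, if_neg (show ¬ (b = t + 1 ∨ b + 1 = t) by omega)]; simp
    · rw [if_neg h5]
      by_cases h6 : b = t + 1 ∨ b + 1 = t
      · rw [if_pos h6]; simp
      · rw [if_neg h6]; simp
  · by_cases h5 : b + 1 = n
    · rw [stg_skew n (t+1) b a, step_last n t b a ht h5 ha h1, stg_skew n t a b, if_pos h5,
        if_neg h3, if_neg (show ¬ (b = t + 1 ∨ b + 1 = t) by omega)]
      by_cases h6 : a = t + 1 ∨ a + 1 = t
      · rw [if_pos h6]; simp; ring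
      · rw [if_neg h6]; simp
    · rw [step_gen n t a b ht h3 h5 h1 h2, if_neg h3, if_neg h5]
      by_cases h6 : a = t + 1 ∨ a + 1 = t <;> by_cases h7 : b = t + 1 ∨ b + 1 = t <;>
        simp [h6, h7]

lemma fin_core (m a b : ℕ) (hm : 3 ≤ m) (ha : a < m + 1) (hb : b < m + 1)
    (h : m ≤ a + 1 ∨ b + 2 ≤ m) :
    |stg (m+1) (m-1) a b| = if (a + 2 ≤ m ∧ (b = a + 1 ∨ a = b + 1)) ∨ (m ≤ a + 1 ∧ b + 2 = m)
    then 1 else 0 := by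
  unfold stg
  by_cases h1 : a = m
  · rw [arr_eq (m+1) (m-1) a b (b + 1 = m) (by omega),
      arr_eq (m+1) (m-1) b a (b + 1 = m ∨ b + 2 = m) (by omega)]
    split_ifs <;> first | (exfalso; omega) | norm_num
  by_cases h2 : a + 1 = m
  · rw [arr_eq (m+1) (m-1) a b (b = m ∨ b + 2 = m) (by omega),
      arr_eq (m+1) (m-1) b a (b = m) (by omega)]
    split_ifs <;> first | (exfalso; omega) | norm_num
  · rw [arr_eq (m+1) (m-1) a b (b = a + 1) (by omega),
      arr_eq (m+1) (m-1) b a (a = b + 1) (by omega)]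
    split_ifs <;> first | (exfalso; omega) | norm_num

lemma fin_abs (m a b : ℕ) (hm : 3 ≤ m) (ha : a < m + 1) (hb : b < m + 1) :
    |stg (m+1) (m-1) a b| = if (m - a = 0 ∧ m - b = 2) ∨ (m - a = 2 ∧ m - b = 0) ∨
       (m - a = 1 ∧ m - b = 2) ∨ (m - a = 2 ∧ m - b = 1) ∨
       (2 ≤ m - a ∧ m - b = m - a + 1) ∨ (2 ≤ m - b ∧ m - a = m - b + 1)
    then 1 else 0 := by
  obtain ⟨c, hc⟩ : ∃ c, m = a + c := ⟨m - a, by omega⟩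
  obtain ⟨d, hd⟩ : ∃ d, m = b + d := ⟨m - b, by omega⟩
  have hc' : m - a = c := by omega
  have hd' : m - b = d := by omega
  rw [hc', hd']
  by_cases h : m ≤ a + 1 ∨ b + 2 ≤ m
  · rw [fin_core m a b hm ha hb h]
    apply if_congr _ rfl rfl
    clear hc' hd'
    constructor <;> intro h' <;> omega
  · rw [stg_skew, abs_neg, fin_core m b a hm hb ha (by omega)]
    apply if_congr _ rfl rfl
    clear hc' hd'
    constructor <;> intro h' <;> omega

theorem cyclic_cycle_type_Dn (n : ℕ) [NeZero n] (hn : 4 ≤ n) :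
    ∃ C : Matrix (ZMod n) (ZMod n) ℤ,
      MutEquiv (cycleMatrix n (fun _ => 1)) C ∧
      ∃ e : ZMod n ≃ Fin n, ∀ i j, |C i j| = DnAdj n (e i) (e j) := by
  obtain ⟨m, rfl⟩ : ∃ m, n = m + 1 := ⟨n - 1, by omega⟩
  have key : ∀ t, t + 2 ≤ m + 1 → MutEquiv (cycleMatrix (m+1) (fun _ => 1))
      (Matrix.of fun i j : ZMod (m+1) => stg (m+1) t i.val j.val) := by
    intro t
    induction t with
    | zero =>
      intro _
      have : cycleMatrix (m+1) (fun _ => 1) =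
          (Matrix.of fun i j : ZMod (m+1) => stg (m+1) 0 i.val j.val) := by
        ext i j
        have hs : ∀ i j : ZMod (m+1), j = i + 1 ↔
            (j.val = i.val + 1 ∨ (i.val = m ∧ j.val = 0)) := by
          intro i j
          have hi := ZMod.val_lt i
          have hj := ZMod.val_lt j
          have h1 : (1 : ZMod (m+1)).val = 1 := ZMod.val_one'' (by omega)
          rw [← (ZMod.val_injective (m+1)).eq_iff, ZMod.val_add, h1]
          rcases Nat.lt_or_ge (i.val + 1) (m+1) with h | h
          · rw [Nat.mod_eq_of_lt h]; omega
          · have : i.val + 1 = m + 1 := by omega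
            rw [this, Nat.mod_self]; omega
        have hi := ZMod.val_lt i
        have hj := ZMod.val_lt j
        simp only [cycleMatrix, Matrix.of_apply, hs, stg]
        rw [arr_eq (m+1) 0 i.val j.val (j.val = i.val + 1 ∨ (i.val = m ∧ j.val = 0)) (by omega),
          arr_eq (m+1) 0 j.val i.val (i.val = j.val + 1 ∨ (j.val = m ∧ i.val = 0)) (by omega)]
        split_ifs <;> first | omega | norm_num
      rw [this]
      exact Relation.ReflTransGen.refl
    | succ t ih =>
      intro h
      refine Relation.ReflTransGen.tail (ih (by omega)) ⟨(t : ZMod (m+1)), ?_⟩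
      have hv : ((t : ℕ) : ZMod (m+1)).val = t := ZMod.val_cast_of_lt (by omega)
      ext i j
      have hk : ∀ i : ZMod (m+1), i = (t : ZMod (m+1)) ↔ i.val = t := by
        intro i
        rw [← (ZMod.val_injective (m+1)).eq_iff, hv]
      simp only [mutate, Matrix.of_apply, hk, hv]
      exact step_eq (m+1) t _ _ (by omega) (ZMod.val_lt i) (ZMod.val_lt j)
  have hinj : Function.Injective (fun i : ZMod (m+1) => (⟨m - i.val, by omega⟩ : Fin (m+1))) := by
    intro i j h
    have h' : m - i.val = m - j.val := congrArg Fin.val h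
    have hi := ZMod.val_lt i
    have hj := ZMod.val_lt j
    exact ZMod.val_injective (m+1) (by omega)
  have hbij := (Fintype.bijective_iff_injective_and_card _).2 ⟨hinj, by simp [ZMod.card]⟩
  refine ⟨_, key (m - 1) (by omega), Equiv.ofBijective _ hbij, ?_⟩
  intro i j
  have hi := ZMod.val_lt i
  have hj := ZMod.val_lt j
  simp only [DnAdj, Matrix.of_apply, Equiv.ofBijective_apply]
  exact fin_abs m _ _ (by omega) hi hj
end

section
/- Let B₁ and B₂ be skew-symmetric n×n integer matrices such that |(B₁)_{ij}| = |(B₂)_{ij}| for all i, j, and such that the simple graph on vertex set {1,…,n} in which i and j are adjacent exactly when (B₁)_{ij} ≠ 0 contains no cycles (i.e., is a forest). Then B₁ and B₂ are mutation equivalent. -/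
open Matrix

namespace ForestMut

def Skew {n : ℕ} (X : Matrix (Fin n) (Fin n) ℤ) : Prop := ∀ i j, X j i = - X i j

def flip {n : ℕ} (X : Matrix (Fin n) (Fin n) ℤ) (k : Fin n) : Matrix (Fin n) (Fin n) ℤ :=
  Matrix.of fun i j => if i = k ∨ j = k then -(X i j) else X i j

def zr {n : ℕ} (v : Fin n) (X : Matrix (Fin n) (Fin n) ℤ) : Matrix (Fin n) (Fin n) ℤ :=
  Matrix.of fun i j => if i = v ∨ j = v then 0 else X i j

def SS {n : ℕ} (X : Matrix (Fin n) (Fin n) ℤ) (k : Fin n) : Prop :=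
  (∀ j, 0 ≤ X k j) ∨ (∀ j, X k j ≤ 0)

def R {n : ℕ} (X Y : Matrix (Fin n) (Fin n) ℤ) : Prop := ∃ k, SS X k ∧ Y = flip X k

lemma flip_apply {n : ℕ} (X : Matrix (Fin n) (Fin n) ℤ) (k i j : Fin n) :
    flip X k i j = if i = k ∨ j = k then -(X i j) else X i j := rfl

lemma zr_apply {n : ℕ} (X : Matrix (Fin n) (Fin n) ℤ) (k i j : Fin n) :
    zr k X i j = if i = k ∨ j = k then 0 else X i j := rfl

lemma flip_skew {n : ℕ} {X : Matrix (Fin n) (Fin n) ℤ} (h : Skew X) (k : Fin n) :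
    Skew (flip X k) := by
  intro i j
  have := h i j
  simp only [flip_apply]
  grind

lemma zr_skew {n : ℕ} {X : Matrix (Fin n) (Fin n) ℤ} (h : Skew X) (k : Fin n) :
    Skew (zr k X) := by
  intro i j
  have := h i j
  simp only [zr_apply]
  grind

lemma flip_abs {n : ℕ} (X : Matrix (Fin n) (Fin n) ℤ) (k i j : Fin n) :
    |flip X k i j| = |X i j| := by
  rw [flip_apply]; split_ifs <;> simp

lemma mutate_eq_flip {n : ℕ} {X : Matrix (Fin n) (Fin n) ℤ} (h : Skew X) {k : Fin n}
    (hk : SS X k) : mutate X k = flip X k := by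
  ext i j
  rw [flip_apply]
  simp only [mutate, Matrix.of_apply]
  split_ifs with hc
  · rfl
  · have h1 : X i k = - X k i := h k i
    rcases hk with hk | hk
    · have a := hk i
      have b := hk j
      rw [h1, max_eq_right (by omega : -X k i ≤ 0), max_eq_right (by omega : -X k j ≤ 0)]
      simp
    · have a := hk i
      have b := hk j
      rw [h1, max_eq_right (by omega : X k j ≤ 0), max_eq_right (by omega : - -X k i ≤ 0)]
      simp

lemma mutEquiv_of_R {n : ℕ} {X Y : Matrix (Fin n) (Fin n) ℤ} (h : Skew X)
    (hr : Relation.ReflTransGen R X Y) : MutEquiv X Y ∧ Skew Y := by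
  induction hr with
  | refl => exact ⟨Relation.ReflTransGen.refl, h⟩
  | tail _ hs ih =>
    obtain ⟨k, hk, rfl⟩ := hs
    exact ⟨ih.1.tail ⟨k, (mutate_eq_flip ih.2 hk).symm⟩, flip_skew ih.2 k⟩

lemma exists_leaf {V : Type*} [Finite V] {G : SimpleGraph V} (h : G.IsAcyclic) {a b : V}
    (hab : G.Adj a b) : ∃ v u, G.Adj v u ∧ ∀ w, G.Adj v w → w = u := by
  classical
  have : Nonempty V := ⟨a⟩
  have ⟨u, v, p, hp, hmax⟩ := SimpleGraph.Walk.exists_isPath_forall_isPath_length_le_length G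
  have hpos : 1 ≤ p.length := by
    have := hmax a b hab.toWalk (by simp [hab.ne])
    simpa using this
  have hnil : ¬p.Nil := by
    intro hn
    have := SimpleGraph.Walk.nil_iff_length_eq.mp hn
    omega
  refine ⟨u, _, p.adj_snd hnil, fun w hadj ↦ ?_⟩
  apply h.eq_snd_of_adj_start hp hadj
  have : ¬(p.cons hadj.symm).IsPath := by grind [SimpleGraph.Walk.length_cons]
  grind [hp.cons]

lemma leaf_SS {n : ℕ} {X : Matrix (Fin n) (Fin n) ℤ} {v u : Fin n}
    (hl : ∀ w, X v w ≠ 0 → w = u) : SS X v := by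
  rcases le_total 0 (X v u) with h | h
  · left; intro j; by_cases hj : X v j = 0
    · omega
    · rw [hl j hj]; exact h
  · right; intro j; by_cases hj : X v j = 0
    · omega
    · rw [hl j hj]; exact h

lemma zr_flip_self {n : ℕ} (X : Matrix (Fin n) (Fin n) ℤ) (v : Fin n) :
    zr v (flip X v) = zr v X := by
  ext i j; simp only [zr_apply, flip_apply]; grind

lemma zr_flip {n : ℕ} (X : Matrix (Fin n) (Fin n) ℤ) (v k : Fin n) :
    zr v (flip X k) = flip (zr v X) k := by
  ext i j; simp only [zr_apply, flip_apply]; grind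

lemma lift_step {n : ℕ} {X Y' : Matrix (Fin n) (Fin n) ℤ} {v u : Fin n} (h : Skew X)
    (hl : ∀ w, X v w ≠ 0 → w = u) (hr : R (zr v X) Y') :
    ∃ Y, Relation.ReflTransGen R X Y ∧ Skew Y ∧ (∀ i j, |Y i j| = |X i j|) ∧ zr v Y = Y' := by
  obtain ⟨k, hk, rfl⟩ := hr
  by_cases hkv : k = v
  · subst hkv
    refine ⟨X, .refl, h, fun _ _ => rfl, ?_⟩
    ext i j; simp only [zr_apply, flip_apply]; grind
  have hk' : (∀ j, j ≠ v → 0 ≤ X k j) ∨ (∀ j, j ≠ v → X k j ≤ 0) := by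
    rcases hk with hk | hk
    · left; intro j hj; have := hk j; simpa [zr_apply, hkv, hj] using this
    · right; intro j hj; have := hk j; simpa [zr_apply, hkv, hj] using this
  by_cases hs : SS X k
  · exact ⟨flip X k, .single ⟨k, hs, rfl⟩, flip_skew h k, flip_abs X k, zr_flip X v k⟩
  · have hs2 : SS (flip X v) k := by
      unfold SS at hs ⊢
      simp only [flip_apply]
      rcases hk' with hk | hk
      · left
        intro j
        by_cases hj : j = v
        · subst hj
          simp only [or_true, if_true]
          by_contra hc
          exact hs (Or.inl fun i => by
            by_cases hi : i = j
            · subst hi; omega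
            · exact hk i hi)
        · simp only [hkv, hj, or_self, if_false]; exact hk j hj
      · right
        intro j
        by_cases hj : j = v
        · subst hj
          simp only [or_true, if_true]
          by_contra hc
          exact hs (Or.inr fun i => by
            by_cases hi : i = j
            · subst hi; omega
            · exact hk i hi)
        · simp only [hkv, hj, or_self, if_false]; exact hk j hj
    refine ⟨flip (flip X v) k, .tail (.single ⟨v, leaf_SS hl, rfl⟩) ⟨k, hs2, rfl⟩,
      flip_skew (flip_skew h v) k, fun i j => by rw [flip_abs, flip_abs], ?_⟩
    rw [zr_flip, zr_flip_self]

lemma leaf_of_abs {n : ℕ} {X Y : Matrix (Fin n) (Fin n) ℤ} {v u : Fin n}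
    (ha : ∀ i j, |Y i j| = |X i j|) (hl : ∀ w, X v w ≠ 0 → w = u) :
    ∀ w, Y v w ≠ 0 → w = u := by
  intro w hw
  apply hl
  rw [← abs_pos, ← ha, abs_pos]; exact hw

lemma lift_chain {n : ℕ} {X Y' : Matrix (Fin n) (Fin n) ℤ} {v u : Fin n} (h : Skew X)
    (hl : ∀ w, X v w ≠ 0 → w = u) (hr : Relation.ReflTransGen R (zr v X) Y') :
    ∃ Y, Relation.ReflTransGen R X Y ∧ Skew Y ∧ (∀ i j, |Y i j| = |X i j|) ∧ zr v Y = Y' := by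
  induction hr with
  | refl => exact ⟨X, .refl, h, fun _ _ => rfl, rfl⟩
  | tail _ hs ih =>
    obtain ⟨Y, h1, h2, h3, rfl⟩ := ih
    obtain ⟨Z, g1, g2, g3, g4⟩ := lift_step h2 (leaf_of_abs h3 hl) hs
    exact ⟨Z, h1.trans g1, g2, fun i j => (g3 i j).trans (h3 i j), g4⟩

lemma main {n : ℕ} (N : ℕ) : ∀ (B C : Matrix (Fin n) (Fin n) ℤ), Skew B → Skew C →
    (∀ i j, |B i j| = |C i j|) →
    (SimpleGraph.fromRel fun i j => B i j ≠ 0).IsAcyclic →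
    (Finset.univ.filter fun p : Fin n × Fin n => B p.1 p.2 ≠ 0).card ≤ N →
    Relation.ReflTransGen R B C := by
  induction N with
  | zero =>
    intro B C hB hC ha _ hN
    have h0 : ∀ i j, B i j = 0 := by
      intro i j
      by_contra hc
      have : (i, j) ∈ (Finset.univ.filter fun p : Fin n × Fin n => B p.1 p.2 ≠ 0) := by
        simpa using hc
      rw [Finset.card_eq_zero.mp (Nat.le_zero.mp hN)] at this
      simp at this
    have : B = C := by
      ext i j
      have := ha i j
      rw [h0, abs_zero] at this
      rw [h0, abs_eq_zero.mp this.symm]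
    rw [this]
  | succ N ih =>
    intro B C hB hC ha hG hN
    by_cases hz : ∀ i j, B i j = 0
    · have : B = C := by
        ext i j
        have := ha i j
        rw [hz, abs_zero] at this
        rw [hz, abs_eq_zero.mp this.symm]
      rw [this]
    push Not at hz
    obtain ⟨a, b, hab⟩ := hz
    have hadj : ∀ i j, (SimpleGraph.fromRel fun i j => B i j ≠ 0).Adj i j ↔ B i j ≠ 0 := by
      intro i j
      rw [SimpleGraph.fromRel_adj]
      have := hB i j
      constructor
      · rintro ⟨_, h | h⟩ <;> omega
      · intro h
        refine ⟨?_, Or.inl h⟩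
        rintro rfl
        omega
    obtain ⟨v, u, hvu, hl⟩ := exists_leaf hG ((hadj a b).mpr hab)
    rw [hadj] at hvu
    have hl' : ∀ w, B v w ≠ 0 → w = u := fun w hw => hl w ((hadj v w).mpr hw)
    have hchain : Relation.ReflTransGen R (zr v B) (zr v C) := by
      apply ih _ _ (zr_skew hB v) (zr_skew hC v)
      · intro i j; simp only [zr_apply]; split_ifs
        · rfl
        · exact ha i j
      · refine hG.anti ?_
        intro i j hij
        rw [hadj]
        rw [SimpleGraph.fromRel_adj] at hij
        simp only [zr_apply] at hij
        have := hB i j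
        grind
      · have hlt : (Finset.univ.filter fun p : Fin n × Fin n => zr v B p.1 p.2 ≠ 0).card <
            (Finset.univ.filter fun p : Fin n × Fin n => B p.1 p.2 ≠ 0).card := by
          apply Finset.card_lt_card
          rw [Finset.ssubset_iff_of_subset]
          · exact ⟨(v, u), by simpa using hvu, by simp [zr_apply]⟩
          · intro p
            simp only [Finset.mem_filter, Finset.mem_univ, true_and, zr_apply]
            grind
        omega
    obtain ⟨Y, h1, h2, h3, h4⟩ := lift_chain hB hl' hchain
    have hlY := leaf_of_abs h3 hl'
    have hlC := leaf_of_abs (fun i j => (ha i j).symm) hl'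
    have key : ∀ Z : Matrix (Fin n) (Fin n) ℤ, Skew Z → (∀ w, Z v w ≠ 0 → w = u) →
        zr v Z = zr v C → Z v u = C v u → Z = C := by
      intro Z hZ hlZ hzr he
      have hrow : ∀ j, Z v j = C v j := by
        intro j
        by_cases hj : j = u
        · rw [hj, he]
        · have e1 : Z v j = 0 := by by_contra hc; exact hj (hlZ j hc)
          have e2 : C v j = 0 := by by_contra hc; exact hj (hlC j hc)
          rw [e1, e2]
      ext i j
      by_cases hi : i = v
      · rw [hi, hrow]
      by_cases hj : j = v
      · rw [hj, hZ v i, hC v i, hrow]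
      have := congrFun (congrFun hzr i) j
      simpa [zr_apply, hi, hj] using this
    have habs : |Y v u| = |C v u| := (h3 v u).trans (ha v u)
    rcases abs_eq_abs.mp habs with he | he
    · rw [← key Y h2 hlY h4 he]; exact h1
    · have := key (flip Y v) (flip_skew h2 v) (leaf_of_abs (flip_abs Y v) hlY)
        ((zr_flip_self Y v).trans h4) (by simp [flip_apply, he])
      rw [← this]
      exact h1.tail ⟨v, leaf_SS hlY, rfl⟩

end ForestMut

/-- Two skew-symmetric integer matrices with the same entrywise absolute values whose
underlying graph is a forest are mutation equivalent. -/
theorem forest_orientations_mutation_equiv {n : ℕ}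
    (B₁ B₂ : Matrix (Fin n) (Fin n) ℤ)
    (h₁ : B₁ᵀ = -B₁) (h₂ : B₂ᵀ = -B₂)
    (habs : ∀ i j, |B₁ i j| = |B₂ i j|)
    (hforest : (SimpleGraph.fromRel fun i j => B₁ i j ≠ 0).IsAcyclic) :
    MutEquiv B₁ B₂ := by
  have s1 : ForestMut.Skew B₁ := fun i j => congrFun (congrFun h₁ i) j
  have s2 : ForestMut.Skew B₂ := fun i j => congrFun (congrFun h₂ i) j
  exact (ForestMut.mutEquiv_of_R s1 (ForestMut.main _ B₁ B₂ s1 s2 habs hforest le_rfl)).1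
end

section
/- Let n ≥ 3 and let B be a skew-symmetric n×n integer matrix such that the simple graph on vertex set {1,…,n} in which i and j are adjacent exactly when b_{ij} ≠ 0 is connected, and such that |b_{ij}| ≥ 3 for some pair of indices i, j. Then the mutation class of B is infinite. -/
open Matrix

theorem skew_apply {n : ℕ} {C : Matrix (Fin n) (Fin n) ℤ} (h : Cᵀ = -C) (i j : Fin n) :
    C i j = - C j i := by
  have := congrFun (congrFun h j) i
  simpa using this

theorem mutate_skew {n : ℕ} {C : Matrix (Fin n) (Fin n) ℤ} (h : Cᵀ = -C) (k : Fin n) :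
    (mutate C k)ᵀ = -(mutate C k) := by
  ext a b
  simp only [mutate, Matrix.transpose_apply, Matrix.neg_apply, Matrix.of_apply]
  rw [skew_apply h b a, skew_apply h b k, skew_apply h k a]
  by_cases hh : a = k ∨ b = k
  · rw [if_pos hh, if_pos hh.symm]
  · rw [if_neg hh, if_neg (fun h' => hh h'.symm)]
    simp only [neg_neg]; ring

theorem mutate_row {n : ℕ} (C : Matrix (Fin n) (Fin n) ℤ) (k a : Fin n) :
    mutate C k k a = - C k a := by simp [mutate]

theorem mutate_col {n : ℕ} (C : Matrix (Fin n) (Fin n) ℤ) (k a : Fin n) :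
    mutate C k a k = - C a k := by simp [mutate]

theorem mutate_opp {n : ℕ} {C : Matrix (Fin n) (Fin n) ℤ} (h : Cᵀ = -C) {k a b : Fin n}
    (ha : a ≠ k) (hb : b ≠ k) :
    mutate C k a b = C a b + max (-(C k a)) 0 * max (-(C b k)) 0
      - max (C k a) 0 * max (C b k) 0 := by
  rw [mutate, Matrix.of_apply, if_neg (by tauto), skew_apply h a k, skew_apply h k b]
  simp only [neg_neg]

def GoodT (x y z : ℤ) : Prop :=
  (3 ≤ x ∧ 0 ≤ y ∧ 0 ≤ z ∧ 0 < y + z) ∨ (x ≤ -3 ∧ y ≤ 0 ∧ z ≤ 0 ∧ y + z < 0)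

theorem max_facts (a b c : ℤ) :
    (0 ≤ a → 0 ≤ b → c + max (-a) 0 * max (-b) 0 - max a 0 * max b 0 = c - a * b) ∧
    (a ≤ 0 → b ≤ 0 → c + max (-a) 0 * max (-b) 0 - max a 0 * max b 0 = c + a * b) := by
  constructor
  · intro ha hb
    rw [max_eq_right (by omega : -a ≤ 0), max_eq_left ha, max_eq_left hb]; ring
  · intro ha hb
    rw [max_eq_left (by omega : 0 ≤ -a), max_eq_left (by omega : 0 ≤ -b), max_eq_right ha]; ring

theorem key_cases {x y z : ℤ} (hx : 3 ≤ x ∨ 3 ≤ -x) (hyz : y ≠ 0 ∨ z ≠ 0)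
    (hg : ¬ ((3 ≤ x ∧ 0 ≤ y ∧ 0 ≤ z ∧ 0 < y + z) ∨ (x ≤ -3 ∧ y ≤ 0 ∧ z ≤ 0 ∧ y + z < 0))) :
    (0 ≤ x ∧ y ≤ 0 ∧ z ≤ 0 ∨ x ≤ 0 ∧ 0 ≤ y ∧ 0 ≤ z) ∨ (0 ≤ x ∧ 0 < y ∧ z < 0 ∨
      x ≤ 0 ∧ y < 0 ∧ 0 < z) ∨ (0 ≤ x ∧ y < 0 ∧ 0 < z ∨ x ≤ 0 ∧ 0 < y ∧ z < 0) := by omega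

theorem good_start {n : ℕ} {C : Matrix (Fin n) (Fin n) ℤ} (h : Cᵀ = -C) {i j k : Fin n}
    (hij : i ≠ j) (hik : i ≠ k) (hjk : j ≠ k) (hx : 3 ≤ |C i j|)
    (hyz : C j k ≠ 0 ∨ C k i ≠ 0) :
    ∃ D, MutEquiv C D ∧ Dᵀ = -D ∧ GoodT (D i j) (D j k) (D k i) := by
  by_cases hg : GoodT (C i j) (C j k) (C k i)
  · exact ⟨C, Relation.ReflTransGen.refl, h, hg⟩
  suffices H : ∃ l, GoodT (mutate C l i j) (mutate C l j k) (mutate C l k i) by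
    obtain ⟨l, hl⟩ := H
    exact ⟨_, Relation.ReflTransGen.single ⟨l, rfl⟩, mutate_skew h l, hl⟩
  have Mi := mutate_opp h (k := i) hij.symm hik.symm
  have Mj := mutate_opp h (k := j) hjk.symm hij
  have Mk := mutate_opp h (k := k) hik hjk
  have ri := mutate_row C i j
  have ci := mutate_col C i k
  have rj := mutate_row C j k
  have cj := mutate_col C j i
  have rk := mutate_row C k i
  have ck := mutate_col C k j
  generalize C i j = x at *
  generalize C j k = y at *
  generalize C k i = z at *
  have Fi := max_facts x z y
  have Fj := max_facts y x z
  have Fk := max_facts z y x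
  rw [le_abs] at hx
  simp only [GoodT] at *
  have key := key_cases hx hyz hg
  rcases key with (⟨h1, h2, h3⟩ | ⟨h1, h2, h3⟩) | (⟨h1, h2, h3⟩ | ⟨h1, h2, h3⟩) |
      (⟨h1, h2, h3⟩ | ⟨h1, h2, h3⟩)
  · refine ⟨k, ?_⟩
    rw [rk, ck, Mk, Fk.2 h3 h2]
    have := mul_nonneg_of_nonpos_of_nonpos h3 h2
    clear Mi Mj Mk Fi Fj Fk ri ci rj cj rk ck
    omega
  · refine ⟨k, ?_⟩
    rw [rk, ck, Mk, Fk.1 h3 h2]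
    have := mul_nonneg h3 h2
    clear Mi Mj Mk Fi Fj Fk ri ci rj cj rk ck
    omega
  · refine ⟨j, ?_⟩
    rw [rj, cj, Mj, Fj.1 h2.le h1]
    have := mul_nonneg h2.le h1
    clear Mi Mj Mk Fi Fj Fk ri ci rj cj rk ck
    omega
  · refine ⟨j, ?_⟩
    rw [rj, cj, Mj, Fj.2 h2.le h1]
    have := mul_nonneg_of_nonpos_of_nonpos h2.le h1
    clear Mi Mj Mk Fi Fj Fk ri ci rj cj rk ck
    omega
  · refine ⟨i, ?_⟩
    rw [ri, ci, Mi, Fi.1 h1 h3.le]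
    have := mul_nonneg h1 h3.le
    clear Mi Mj Mk Fi Fj Fk ri ci rj cj rk ck
    omega
  · refine ⟨i, ?_⟩
    rw [ri, ci, Mi, Fi.2 h1 h3.le]
    have := mul_nonneg_of_nonpos_of_nonpos h1 h3.le
    clear Mi Mj Mk Fi Fj Fk ri ci rj cj rk ck
    omega

theorem good_step {n : ℕ} {C : Matrix (Fin n) (Fin n) ℤ} (h : Cᵀ = -C) {i j k : Fin n}
    (hij : i ≠ j) (hik : i ≠ k) (hjk : j ≠ k)
    (hg : GoodT (C i j) (C j k) (C k i)) :
    ∃ l, GoodT (mutate C l i j) (mutate C l j k) (mutate C l k i) ∧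
      |C i j| + |C j k| + |C k i| <
      |mutate C l i j| + |mutate C l j k| + |mutate C l k i| := by
  have Mi := mutate_opp h (k := i) hij.symm hik.symm
  have Mj := mutate_opp h (k := j) hjk.symm hij
  have ri := mutate_row C i j
  have ci := mutate_col C i k
  have rj := mutate_row C j k
  have cj := mutate_col C j i
  generalize C i j = x at *
  generalize C j k = y at *
  generalize C k i = z at *
  have Fi := max_facts x z y
  have Fj := max_facts y x z
  simp only [GoodT] at *
  rcases hg with ⟨hx, hy, hz, hs⟩ | ⟨hx, hy, hz, hs⟩
  · rcases le_total y z with hyz | hyz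
    · refine ⟨i, ?_⟩
      rw [ri, ci, Mi, Fi.1 (by omega) hz]
      have : 3 * z ≤ x * z := by nlinarith
      rw [abs_of_nonneg (by omega : 0 ≤ x), abs_of_nonneg hy, abs_of_nonneg hz, abs_neg, abs_neg,
        abs_of_nonneg (by omega : 0 ≤ x), abs_of_nonneg hz,
        abs_of_nonpos (by omega : y - x * z ≤ 0)]
      omega
    · refine ⟨j, ?_⟩
      rw [rj, cj, Mj, Fj.1 hy (by omega)]
      have : 3 * y ≤ y * x := by nlinarith
      rw [abs_of_nonneg (by omega : 0 ≤ x), abs_of_nonneg hy, abs_of_nonneg hz, abs_neg, abs_neg,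
        abs_of_nonneg (by omega : 0 ≤ x), abs_of_nonneg hy,
        abs_of_nonpos (by omega : z - y * x ≤ 0)]
      omega
  · rcases le_total z y with hyz | hyz
    · refine ⟨i, ?_⟩
      rw [ri, ci, Mi, Fi.2 (by omega) hz]
      have : 3 * (-z) ≤ x * z := by nlinarith
      rw [abs_of_nonpos (by omega : x ≤ 0), abs_of_nonpos hy, abs_of_nonpos hz, abs_neg, abs_neg,
        abs_of_nonpos (by omega : x ≤ 0), abs_of_nonpos hz,
        abs_of_nonneg (by omega : 0 ≤ y + x * z)]
      omega
    · refine ⟨j, ?_⟩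
      rw [rj, cj, Mj, Fj.2 hy (by omega)]
      have : 3 * (-y) ≤ y * x := by nlinarith
      rw [abs_of_nonpos (by omega : x ≤ 0), abs_of_nonpos hy, abs_of_nonpos hz, abs_neg, abs_neg,
        abs_of_nonpos (by omega : x ≤ 0), abs_of_nonpos hy,
        abs_of_nonneg (by omega : 0 ≤ z + y * x)]
      omega

/-- A connected skew-symmetric matrix of size `n ≥ 3` with an entry of absolute
value at least 3 has an infinite mutation class. -/
theorem big_entry_infinite_mutation_class {n : ℕ} (hn : 3 ≤ n)
    (B : Matrix (Fin n) (Fin n) ℤ) (hB : Bᵀ = -B)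
    (hconn : (SimpleGraph.fromRel fun i j => B i j ≠ 0).Connected)
    (hbig : ∃ i j, 3 ≤ |B i j|) :
    {C : Matrix (Fin n) (Fin n) ℤ | MutEquiv B C}.Infinite := by
  obtain ⟨i, j, hx⟩ := hbig
  have hij : i ≠ j := by
    rintro rfl
    have := skew_apply hB i i
    have h0 : B i i = 0 := by omega
    rw [h0] at hx
    simp at hx
  obtain ⟨m, hmi, hmj⟩ : ∃ m : Fin n, m ≠ i ∧ m ≠ j := by
    by_contra! hcon
    have hsub : (Finset.univ : Finset (Fin n)) ⊆ {i, j} := by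
      intro m _
      by_cases hm : m = i
      · simp [hm]
      · simp [hcon m hm]
    have h1 := Finset.card_le_card hsub
    have h2 := Finset.card_le_two (a := i) (b := j)
    simp at h1
    omega
  obtain ⟨k, hki, hkj, hyz⟩ : ∃ k, k ≠ i ∧ k ≠ j ∧ (B j k ≠ 0 ∨ B k i ≠ 0) := by
    obtain ⟨w⟩ := hconn.preconnected i m
    obtain ⟨d, -, hd1, hd2⟩ := w.exists_boundary_dart {i, j} (by simp) (by simp [hmi, hmj])
    have hadj := d.adj
    rw [SimpleGraph.fromRel_adj] at hadj
    simp only [Set.mem_insert_iff, Set.mem_singleton_iff, not_or] at hd1 hd2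
    refine ⟨d.snd, hd2.1, hd2.2, ?_⟩
    have s1 := skew_apply hB d.fst d.snd
    rcases hd1 with h | h <;> rw [h] at hadj s1 <;> omega
  obtain ⟨D, hBD, hD, hgD⟩ := good_start hB hij hki.symm hkj.symm hx hyz
  intro hfin
  have hfin' : {C : Matrix (Fin n) (Fin n) ℤ | MutEquiv B C ∧ Cᵀ = -C ∧
      GoodT (C i j) (C j k) (C k i)}.Finite := hfin.subset fun C hC => hC.1
  obtain ⟨M, ⟨hM1, hM2, hM3⟩, hmax⟩ := Set.exists_max_image _
    (fun C : Matrix (Fin n) (Fin n) ℤ => |C i j| + |C j k| + |C k i|) hfin' ⟨D, hBD, hD, hgD⟩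
  obtain ⟨l, hl1, hl2⟩ := good_step hM2 hij hki.symm hkj.symm hM3
  exact absurd (hmax (mutate M l) ⟨hM1.tail ⟨l, rfl⟩, mutate_skew hM2 l, hl1⟩) (not_le.mpr hl2)
end

section
/- The 8×8 matrix B(A₂ □ D₄) of the quiver A₂ □ D₄ is, up to a simultaneous permutation of rows and columns, mutation equivalent to a skew-symmetric 8×8 integer matrix that is an orientation of the diagram E₆^{(1,1)} with all triangles oriented. -/
open Matrix

/-- The arrow relation of the quiver `A₂ □ D₄` on vertex set `Fin 2 × Fin 4`
(first coordinate `0,1` standing for `1,2`; second coordinate `0,1,2,3`):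
arrows `(1,0) → (1,x)` for `x = 1,2,3`; `(2,x) → (2,0)` for `x = 1,2,3`;
`(1,x) → (2,x)` for `x = 1,2,3`; and `(2,0) → (1,0)`. -/
def A2D4arrow : (Fin 2 × Fin 4) → (Fin 2 × Fin 4) → Bool := fun p q =>
  (p.1 == 0 && q.1 == 0 && p.2 == 0 && q.2 != 0) ||
  (p.1 == 1 && q.1 == 1 && q.2 == 0 && p.2 != 0) ||
  (p.1 == 0 && q.1 == 1 && p.2 == q.2 && p.2 != 0) ||
  (p.1 == 1 && p.2 == 0 && q.1 == 0 && q.2 == 0)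

/-- The matrix `B(A₂ □ D₄)` of the quiver `A₂ □ D₄`. -/
def A2D4 : Matrix (Fin 2 × Fin 4) (Fin 2 × Fin 4) ℤ :=
  Matrix.of fun p q =>
    (if A2D4arrow p q then 1 else 0) - (if A2D4arrow q p then 1 else 0)

/-- The weight matrix of the diagram E₆^(1,1), with vertices
t₁ = 0, t₂ = 1, a₁ = 2, a₂ = 3, a₃ = 4, b₁ = 5, b₂ = 6, b₃ = 7. -/
def E6w : Matrix (Fin 8) (Fin 8) ℤ :=
  !![0,1,0,0,0,0,0,0;
     1,0,1,0,0,1,0,0;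
     0,1,0,1,0,2,1,0;
     0,0,1,0,1,1,0,0;
     0,0,0,1,0,0,0,0;
     0,1,2,1,0,0,1,0;
     0,0,1,0,0,1,0,1;
     0,0,0,0,0,0,1,0]

/-- `B` is an orientation of the diagram E₆^(1,1) with all triangles
({t₂,a₁,b₁}, {a₁,b₁,a₂}, {a₁,b₁,b₂}) oriented. -/
def IsOrientedE6_11 (B : Matrix (Fin 8) (Fin 8) ℤ) : Prop :=
  (∀ u v, |B u v| = E6w u v) ∧
  0 < B 1 2 * B 2 5 * B 5 1 ∧
  0 < B 2 5 * B 5 3 * B 3 2 ∧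
  0 < B 2 5 * B 5 6 * B 6 2

set_option maxRecDepth 100000
set_option maxHeartbeats 4000000

def qM0 : Matrix (Fin 8) (Fin 8) ℤ :=
  !![0,-1,1,0,0,0,0,0;
     1,0,0,0,0,-1,0,0;
     -1,0,0,0,-1,1,0,-1;
     0,0,0,0,1,-1,0,0;
     0,0,1,-1,0,0,0,0;
     0,1,-1,1,0,0,1,0;
     0,0,0,0,0,-1,0,1;
     0,0,1,0,0,0,-1,0]

def qM1 : Matrix (Fin 8) (Fin 8) ℤ :=
  !![0,-1,1,0,0,0,0,0;
     1,0,-1,0,0,1,0,0;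
     -1,1,0,1,-1,-1,1,-1;
     0,0,-1,0,1,1,0,0;
     0,0,1,-1,0,0,0,0;
     0,-1,1,-1,0,0,-1,0;
     0,0,-1,0,0,1,0,1;
     0,0,1,0,0,0,-1,0]

def qM2 : Matrix (Fin 8) (Fin 8) ℤ :=
  !![0,1,0,0,0,0,0,0;
     -1,0,1,0,0,-1,0,0;
     0,-1,0,1,-1,0,1,-1;
     0,0,-1,0,1,1,0,0;
     0,0,1,-1,0,0,0,0;
     0,1,0,-1,0,0,-1,0;
     0,0,-1,0,0,1,0,1;
     0,0,1,0,0,0,-1,0]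

def qM3 : Matrix (Fin 8) (Fin 8) ℤ :=
  !![0,1,0,0,0,0,0,0;
     -1,0,1,0,0,-1,0,0;
     0,-1,0,-1,0,1,1,-1;
     0,0,1,0,-1,-1,0,0;
     0,0,0,1,0,0,0,0;
     0,1,-1,1,0,0,-1,0;
     0,0,-1,0,0,1,0,1;
     0,0,1,0,0,0,-1,0]

def qM4 : Matrix (Fin 8) (Fin 8) ℤ :=
  !![0,1,0,0,0,0,0,0;
     -1,0,1,0,0,-1,0,0;
     0,-1,0,-1,0,2,-1,0;
     0,0,1,0,-1,-1,0,0;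
     0,0,0,1,0,0,0,0;
     0,1,-2,1,0,0,1,0;
     0,0,1,0,0,-1,0,-1;
     0,0,0,0,0,0,1,0]

def qE : (Fin 2 × Fin 4) ≃ Fin 8 where
  toFun p := (![![5,1,3,6], ![2,0,4,7]] : Fin 2 → Fin 4 → Fin 8) p.1 p.2
  invFun := ![(1,1),(0,1),(1,0),(0,2),(1,2),(0,0),(0,3),(1,3)]
  left_inv := by decide
  right_inv := by decide

theorem qM0_eq : A2D4.submatrix qE.symm qE.symm = qM0 := by
  ext i j
  revert j
  fin_cases i <;> decide

theorem qM1_eq : qM1 = mutate qM0 5 := by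
  ext i j
  revert j
  fin_cases i <;> decide

theorem qM2_eq : qM2 = mutate qM1 1 := by
  ext i j
  revert j
  fin_cases i <;> decide

theorem qM3_eq : qM3 = mutate qM2 3 := by
  ext i j
  revert j
  fin_cases i <;> decide

theorem qM4_eq : qM4 = mutate qM3 6 := by
  ext i j
  revert j
  fin_cases i <;> decide

/-- `B(A₂ □ D₄)` is, up to simultaneous permutation of rows and columns, mutation
equivalent to an orientation of the diagram E₆^(1,1) with all triangles oriented. -/
theorem a2d4_type_E6_11 :
    ∃ (e : (Fin 2 × Fin 4) ≃ Fin 8) (C : Matrix (Fin 8) (Fin 8) ℤ),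
      MutEquiv (A2D4.submatrix e.symm e.symm) C ∧ IsOrientedE6_11 C := by
  refine ⟨qE, qM4, ?_, ?_⟩
  · rw [qM0_eq]
    exact (((Relation.ReflTransGen.single ⟨5, qM1_eq⟩).tail ⟨1, qM2_eq⟩).tail ⟨3, qM3_eq⟩).tail
      ⟨6, qM4_eq⟩
  · refine ⟨fun u => ?_, by decide, by decide, by decide⟩
    fin_cases u <;> decide
end
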